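/- arXiv:2509.16162 — 2 statements merged into one kernel-verified Lean document; each statement's English description precedes it below -/
import Mathlib

section
/- For all 0 < p_− < p_+ < 1 and d ≥ 2 there exists a constant C = C(p_−, p_+, d) > 0 such that for every p ∈ [p_−, p_+] and every n ≥ 1, Σ_{e∈𝓔} ℙ(e is U-pivotal for E_n(p)) ≤ C · Σ_{e∈𝓔} ℙ(e is p-pivotal for E_n(p)). -/
open MeasureTheory

namespace CDP

/-- Vertices of the hypercubic lattice `ℤ^d`. -/
abbrev Vertex (d : ℕ) := Fin d → ℤ

/-- Nearest-neighbour adjacency in `ℤ^d`. -/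
def adj {d : ℕ} (x y : Vertex d) : Prop := (∑ i, |x i - y i|) = 1

/-- `e` is a nearest-neighbour (non-oriented) edge of `ℤ^d`, i.e. an element of `𝓔`. -/
def IsNNEdge {d : ℕ} (e : Sym2 (Vertex d)) : Prop := ∃ x y, adj x y ∧ e = s(x, y)

/-- Configurations: labels attached to (unordered) pairs of vertices; only the labels of
nearest-neighbour edges (elements of `𝓔`) are ever relevant. -/
abbrev Config (d : ℕ) := Sym2 (Vertex d) → ℝ

/-- `ℓ^1` norm of a vertex. -/
def norm1 {d : ℕ} (x : Vertex d) : ℤ := ∑ i, |x i|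

/-- The set `Ω`: configurations with values in `[0,1]`, pairwise distinct coordinates on `𝓔`,
and no infinite walk along which the labels are strictly monotone. -/
def goodConfigs (d : ℕ) : Set (Config d) :=
  {U | (∀ e, IsNNEdge e → U e ∈ Set.Icc (0 : ℝ) 1) ∧
    (∀ e f, IsNNEdge e → IsNNEdge f → U e = U f → e = f) ∧
    ¬ ∃ w : ℕ → Vertex d, (∀ i, adj (w i) (w (i + 1))) ∧
      (StrictMono (fun i => U s(w i, w (i + 1))) ∨ StrictAnti (fun i => U s(w i, w (i + 1))))}

/-- A labelling `σ` of the edges by "ever opens" which is consistent with the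
constrained-degree dynamics driven by `U`: an edge (attempting to open at time `U e`)
opens iff at that moment both of its end-vertices have degree `< κ` among the
previously opened edges. -/
def Consistent {d : ℕ} (κ : ℕ) (U : Config d) (σ : Sym2 (Vertex d) → Prop) : Prop :=
  ∀ e, IsNNEdge e →
    (σ e ↔ ∀ v ∈ e,
      Set.ncard {f : Sym2 (Vertex d) | IsNNEdge f ∧ v ∈ f ∧ f ≠ e ∧ U f < U e ∧ σ f} < κ)

/-- `ω_p(U, e) = 1`, i.e. the edge `e` is `p`-open in the constrained-degree percolation
process with constraint `κ` driven by `U`. -/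
def openEdge {d : ℕ} (κ : ℕ) (U : Config d) (p : ℝ) (e : Sym2 (Vertex d)) : Prop :=
  IsNNEdge e ∧ U e ≤ p ∧ ∃ σ, Consistent κ U σ ∧ σ e

/-- `x 0, …, x k` is a path: consecutive vertices adjacent, all vertices distinct. -/
def IsPathOn {d : ℕ} (k : ℕ) (x : ℕ → Vertex d) : Prop :=
  (∀ i < k, adj (x i) (x (i + 1))) ∧ ∀ i ≤ k, ∀ j ≤ k, x i = x j → i = j

/-- The modified one-arm event `E_n(p)`: a path `x_0, …, x_k` with `‖x_0‖₁ = n`,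
`‖x_i‖₁ < n` for `1 ≤ i ≤ k`, `x_k = 0`, whose head consists of `p`-open edges and whose
tail is decreasing (values `≤ p`, strictly decreasing towards the origin). -/
def modifiedOneArm {d : ℕ} (κ n : ℕ) (p : ℝ) (U : Config d) : Prop :=
  ∃ (k : ℕ) (x : ℕ → Vertex d),
    IsPathOn k x ∧ norm1 (x 0) = (n : ℤ) ∧ (∀ i, 1 ≤ i → i ≤ k → norm1 (x i) < (n : ℤ)) ∧
    x k = 0 ∧
    ∃ l ≤ k,
      (∀ i < l, openEdge κ U p s(x i, x (i + 1))) ∧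
      (∀ i, l ≤ i → i < k → U s(x i, x (i + 1)) ≤ p) ∧
      (∀ i, l ≤ i → i + 1 < k → U s(x (i + 1), x (i + 2)) < U s(x i, x (i + 1)))

/-- `a` and `b` are connected by a `p`-open path. -/
def openConn {d : ℕ} (κ : ℕ) (U : Config d) (p : ℝ) (a b : Vertex d) : Prop :=
  ∃ (k : ℕ) (x : ℕ → Vertex d), IsPathOn k x ∧ x 0 = a ∧ x k = b ∧
    ∀ i < k, openEdge κ U p s(x i, x (i + 1))

/-- There is an infinite `p`-open path starting at the origin. -/
def zeroToInf {d : ℕ} (κ : ℕ) (U : Config d) (p : ℝ) : Prop :=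
  ∃ x : ℕ → Vertex d, x 0 = 0 ∧ (∀ i, adj (x i) (x (i + 1))) ∧ Function.Injective x ∧
    ∀ i, openEdge κ U p s(x i, x (i + 1))

/-- `P` is the law of i.i.d. `Uniform[0,1]` labels: a probability measure whose
finite-dimensional cylinder probabilities are products of uniform probabilities. -/
def IsProductUniform {d : ℕ} (P : Measure (Config d)) : Prop :=
  IsProbabilityMeasure P ∧
    ∀ (s : Finset (Sym2 (Vertex d))) (f : Sym2 (Vertex d) → Set ℝ),
      (∀ e ∈ s, MeasurableSet (f e)) →
      P {U | ∀ e ∈ s, U e ∈ f e} = ∏ e ∈ s, volume (f e ∩ Set.Icc 0 1)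

/-- The one-arm probability `θ_n(p)`. -/
noncomputable def theta {d : ℕ} (κ : ℕ) (P : Measure (Config d)) (n : ℕ) (p : ℝ) : ℝ :=
  (P {U | U ∈ goodConfigs d ∧ ∃ b, norm1 b = (n : ℤ) ∧ openConn κ U p 0 b}).toReal

/-- `θ(p) = ℙ(0 ↔ ∞)`. -/
noncomputable def thetaInf {d : ℕ} (κ : ℕ) (P : Measure (Config d)) (p : ℝ) : ℝ :=
  (P {U | U ∈ goodConfigs d ∧ zeroToInf κ U p}).toReal

/-- The critical point `p_c`. -/
noncomputable def pc {d : ℕ} (κ : ℕ) (P : Measure (Config d)) : ℝ :=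
  sSup {p : ℝ | p ∈ Set.Icc (0 : ℝ) 1 ∧ thetaInf κ P p = 0}

/-- The modified one-arm probability `τ_n(p)`. -/
noncomputable def tau {d : ℕ} (κ : ℕ) (P : Measure (Config d)) (n : ℕ) (p : ℝ) : ℝ :=
  (P {U | U ∈ goodConfigs d ∧ modifiedOneArm κ n p U}).toReal

/-- `e` is `p`-pivotal for `E_n(p)` at `U`. -/
def pPivotal {d : ℕ} (κ n : ℕ) (p : ℝ) (e : Sym2 (Vertex d)) (U : Config d) : Prop :=
  U ∈ goodConfigs d ∧ p < U e ∧ Function.update U e p ∈ goodConfigs d ∧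
    ¬ (modifiedOneArm κ n p U ↔ modifiedOneArm κ n p (Function.update U e p))

/-- `e` is `U`-pivotal for `E_n(p)` at `U`. -/
def uPivotal {d : ℕ} (κ n : ℕ) (p : ℝ) (e : Sym2 (Vertex d)) (U : Config d) : Prop :=
  U ∈ goodConfigs d ∧ ∃ U' ∈ goodConfigs d, (∀ f, f ≠ e → U' f = U f) ∧
    ¬ (modifiedOneArm κ n p U ↔ modifiedOneArm κ n p U')

lemma adj_comm {d : ℕ} {x y : Vertex d} (h : adj x y) : adj y x := by
  unfold adj at *
  rw [← h]
  exact Finset.sum_congr rfl fun i _ => abs_sub_comm _ _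

/-- Two edges are near when they share a vertex. -/
def near {d : ℕ} (g h : Sym2 (Vertex d)) : Prop := ∃ v, v ∈ g ∧ v ∈ h

lemma near_comm {d : ℕ} {g h : Sym2 (Vertex d)} (H : near g h) : near h g := by
  obtain ⟨v, h1, h2⟩ := H
  exact ⟨v, h2, h1⟩

lemma near_refl {d : ℕ} (g : Sym2 (Vertex d)) : near g g := by
  induction g with | _ x y => exact ⟨x, by simp, by simp⟩

/-- The edge joining `v` to its neighbour in direction `±` the `i.1`-th unit vector. -/
def incident {d : ℕ} (v : Vertex d) (i : Fin d × Bool) : Sym2 (Vertex d) :=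
  s(v, v + Pi.single i.1 (if i.2 then 1 else -1))

lemma isNNEdge_iff {d : ℕ} {x y : Vertex d} : IsNNEdge s(x, y) ↔ adj x y := by
  constructor
  · rintro ⟨a, b, h, he⟩
    rcases Sym2.eq_iff.1 he with ⟨rfl, rfl⟩ | ⟨rfl, rfl⟩
    · exact h
    · exact adj_comm h
  · intro h
    exact ⟨x, y, h, rfl⟩

lemma exists_incident_of_adj {d : ℕ} {x y : Vertex d} (h : adj x y) :
    ∃ i, incident x i = s(x, y) := by
  unfold adj at h
  have hex : ∃ i, x i - y i ≠ 0 := by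
    by_contra! hc
    simp [hc] at h
  obtain ⟨i, hi⟩ := hex
  have h1 : 1 ≤ |x i - y i| := Int.one_le_abs hi
  rw [← Finset.add_sum_erase _ _ (Finset.mem_univ i)] at h
  have h2 : 0 ≤ ∑ j ∈ Finset.univ.erase i, |x j - y j| :=
    Finset.sum_nonneg fun _ _ => abs_nonneg _
  have h3 : ∑ j ∈ Finset.univ.erase i, |x j - y j| = 0 := by omega
  have h4 : |x i - y i| = 1 := by omega
  rw [Finset.sum_eq_zero_iff_of_nonneg fun _ _ => abs_nonneg _] at h3
  have h5 : ∀ j, j ≠ i → y j = x j := by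
    intro j hj
    have := abs_eq_zero.1 (h3 j (by simp [hj]))
    omega
  have key : ∀ b : Bool, y i = x i + (if b then 1 else -1) → incident x (i, b) = s(x, y) := by
    intro b hb
    unfold incident
    congr 1
    dsimp only
    funext j
    by_cases hj : j = i
    · subst hj
      simp [hb]
    · simp [Pi.single_eq_of_ne hj, h5 j hj]
  rcases (abs_eq (by norm_num : (0 : ℤ) ≤ 1)).1 h4 with h6 | h6
  · exact ⟨(i, false), key false (by simp; omega)⟩
  · exact ⟨(i, true), key true (by simp; omega)⟩

lemma exists_incident {d : ℕ} {v : Vertex d} {g : Sym2 (Vertex d)} (hg : IsNNEdge g)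
    (hv : v ∈ g) : ∃ i, incident v i = g := by
  obtain ⟨x, y, h, rfl⟩ := hg
  rcases Sym2.mem_iff.1 hv with rfl | rfl
  · exact exists_incident_of_adj h
  · obtain ⟨i, hi⟩ := exists_incident_of_adj (adj_comm h)
    exact ⟨i, by rw [hi, Sym2.eq_swap]⟩

lemma finite_incident {d : ℕ} (v : Vertex d) : {g | IsNNEdge g ∧ v ∈ g}.Finite :=
  (Set.finite_range (incident v)).subset fun _ hg => exists_incident hg.1 hg.2

/-- An enumeration of the edges near `e`. -/
noncomputable def nb {d : ℕ} (e : Sym2 (Vertex d)) (i : Fin d × Bool × Bool) :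
    Sym2 (Vertex d) :=
  incident (if i.2.2 then (Quot.out e).1 else (Quot.out e).2) (i.1, i.2.1)

lemma exists_nb {d : ℕ} {e g : Sym2 (Vertex d)} (hg : IsNNEdge g) (h : near e g) :
    ∃ i, nb e i = g := by
  obtain ⟨v, hv, hv'⟩ := h
  have he : s((Quot.out e).1, (Quot.out e).2) = e := Quot.out_eq e
  rw [← he, Sym2.mem_iff] at hv
  obtain ⟨⟨i, b⟩, hi⟩ := exists_incident hg hv'
  rcases hv with rfl | rfl
  · exact ⟨(i, b, true), by simpa [nb] using hi⟩
  · exact ⟨(i, b, false), by simpa [nb] using hi⟩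

lemma finite_near {d : ℕ} (e : Sym2 (Vertex d)) : {g | IsNNEdge g ∧ near e g}.Finite :=
  (Set.finite_range (nb e)).subset fun _ hg => exists_nb hg.1 hg.2

/-! ### Well-foundedness of the influence order -/

/-- `f` is an earlier neighbour of `e`. -/
def prec {d : ℕ} (U : Config d) (f e : Sym2 (Vertex d)) : Prop :=
  IsNNEdge f ∧ IsNNEdge e ∧ near f e ∧ U f < U e

lemma wellFounded_prec_of_noAnti {d : ℕ} {U : Config d}
    (hU : ¬ ∃ w : ℕ → Vertex d, (∀ i, adj (w i) (w (i + 1))) ∧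
      StrictAnti (fun i => U s(w i, w (i + 1)))) : WellFounded (prec U) := by
  let r : Vertex d × Vertex d → Vertex d × Vertex d → Prop := fun a b =>
    a.1 = b.2 ∧ adj a.1 a.2 ∧ U s(a.1, a.2) < U s(b.1, b.2)
  have hr : WellFounded r := by
    rw [wellFounded_iff_isEmpty_descending_chain]
    refine ⟨fun ⟨f, hf⟩ => hU ⟨fun i => (f (i + 1)).1, fun i => ?_, ?_⟩⟩
    · have h1 := (hf i).2.1
      have h2 := (hf (i + 1)).1
      simp only
      rw [h2]
      exact h1
    · refine strictAnti_nat_of_succ_lt fun i => ?_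
      have h1 := (hf (i + 1)).2.2
      have h2 := (hf (i + 1)).1
      have h3 := (hf (i + 2)).1
      simp only
      rw [h3]
      rw [h2] at h1 ⊢
      exact h1
  have main : ∀ a : Vertex d × Vertex d, ∀ f, IsNNEdge f → a.2 ∈ f → U f < U s(a.1, a.2) →
      Acc (prec U) f := by
    intro a
    induction a using hr.induction with
    | _ a ih =>
      by_contra! hc
      let X : Set (Sym2 (Vertex d)) :=
        {f | IsNNEdge f ∧ a.2 ∈ f ∧ U f < U s(a.1, a.2) ∧ ¬ Acc (prec U) f}
      have hX : X.Finite := (finite_incident a.2).subset fun f hf => ⟨hf.1, hf.2.1⟩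
      obtain ⟨f0, h01, h02, h03, h04⟩ := hc
      obtain ⟨f, ⟨hf1, hf2, hf3, hf4⟩, hmin⟩ :=
        Set.exists_min_image X U hX ⟨f0, h01, h02, h03, h04⟩
      apply hf4
      refine Acc.intro _ fun g hg => ?_
      obtain ⟨hg1, -, ⟨v, hv, hv'⟩, hlt⟩ := hg
      obtain ⟨z, rfl⟩ := Sym2.mem_iff_exists.1 hf2
      rcases Sym2.mem_iff.1 hv' with rfl | rfl
      · by_contra hga
        exact absurd (hmin g ⟨hg1, hv, hlt.trans hf3, hga⟩) (not_le.2 hlt)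
      · exact ih (a.2, v) ⟨rfl, isNNEdge_iff.1 hf1, hf3⟩ g hg1 hv hlt
  refine ⟨fun f => Acc.intro _ fun g hg => ?_⟩
  obtain ⟨hg1, -, ⟨v, hv, hv'⟩, hlt⟩ := hg
  obtain ⟨z, rfl⟩ := Sym2.mem_iff_exists.1 hv'
  exact main (z, v) g hg1 hv (by simpa only [Sym2.eq_swap] using hlt)

lemma wellFounded_prec {d : ℕ} {U : Config d} (hU : U ∈ goodConfigs d) :
    WellFounded (prec U) :=
  wellFounded_prec_of_noAnti fun ⟨w, h1, h2⟩ => hU.2.2 ⟨w, h1, Or.inr h2⟩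

lemma wellFounded_prec_neg {d : ℕ} {U : Config d} (hU : U ∈ goodConfigs d) :
    WellFounded (prec (fun e => -U e)) :=
  wellFounded_prec_of_noAnti fun ⟨w, h1, h2⟩ =>
    hU.2.2 ⟨w, h1, Or.inl fun _ _ hij => neg_lt_neg_iff.1 (h2 hij)⟩

/-! ### The dynamics restricted to a set of present edges -/

/-- The constrained-degree dynamics in which only the edges of `A` attempt to open. -/
def ConsistentOn {d : ℕ} (κ : ℕ) (U : Config d) (A : Set (Sym2 (Vertex d)))
    (σ : Sym2 (Vertex d) → Prop) : Prop :=
  ∀ e, IsNNEdge e → (σ e ↔ e ∈ A ∧ ∀ v ∈ e,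
      Set.ncard {f : Sym2 (Vertex d) | IsNNEdge f ∧ v ∈ f ∧ f ≠ e ∧ U f < U e ∧ σ f} < κ)

lemma exists_consistentOn {d : ℕ} (κ : ℕ) {U : Config d} (hwf : WellFounded (prec U))
    (A : Set (Sym2 (Vertex d))) : ∃ σ, ConsistentOn κ U A σ := by
  let F : (e : Sym2 (Vertex d)) → ((f : Sym2 (Vertex d)) → prec U f e → Prop) → Prop :=
    fun e ih => e ∈ A ∧ ∀ v ∈ e, Set.ncard {f | ∃ h : prec U f e, v ∈ f ∧ ih f h} < κ
  refine ⟨hwf.fix F, fun e he => ?_⟩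
  rw [hwf.fix_eq]
  refine and_congr_right fun _ => forall₂_congr fun v hv => ?_
  have : {f | ∃ h : prec U f e, v ∈ f ∧ hwf.fix F f} =
      {f | IsNNEdge f ∧ v ∈ f ∧ f ≠ e ∧ U f < U e ∧ hwf.fix F f} := by
    ext f
    constructor
    · rintro ⟨⟨h1, h2, h3, h4⟩, h5, h6⟩
      exact ⟨h1, h5, fun h => by simp [h] at h4, h4, h6⟩
    · rintro ⟨h1, h2, h3, h4, h5⟩
      exact ⟨⟨h1, he, ⟨v, h2, hv⟩, h4⟩, h2, h5⟩
  rw [this]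

/-- Removing edges that are closed or late does not affect the earlier edges. -/
lemma ConsistentOn.congr_below {d κ : ℕ} {U : Config d} (hwf : WellFounded (prec U))
    {A A' : Set (Sym2 (Vertex d))} {σ σ' : Sym2 (Vertex d) → Prop}
    (h : ConsistentOn κ U A σ) (h' : ConsistentOn κ U A' σ') (s : ℝ)
    (hA : ∀ e, IsNNEdge e → U e < s → (e ∈ A ↔ e ∈ A') ∨ (¬ σ e ∧ e ∉ A')) :
    ∀ e, IsNNEdge e → U e < s → (σ e ↔ σ' e) := by
  intro e
  induction e using hwf.induction with
  | _ e ih =>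
    intro he hs
    rcases hA e he hs with h1 | ⟨h1, h2⟩
    · rw [h e he, h' e he, h1]
      refine and_congr_right fun _ => forall₂_congr fun v hv => ?_
      have : {f | IsNNEdge f ∧ v ∈ f ∧ f ≠ e ∧ U f < U e ∧ σ f} =
          {f | IsNNEdge f ∧ v ∈ f ∧ f ≠ e ∧ U f < U e ∧ σ' f} := by
        ext f
        refine and_congr_right fun hf => and_congr_right fun hvf => and_congr_right fun _ =>
          and_congr_right fun hlt => ?_
        exact ih f ⟨hf, he, ⟨v, hvf, hv⟩, hlt⟩ hf (hlt.trans hs)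
      rw [this]
    · refine iff_of_false h1 fun h3 => h2 ((h' e he).1 h3).1

lemma ConsistentOn.congr {d κ : ℕ} {U : Config d} (hwf : WellFounded (prec U))
    {A A' : Set (Sym2 (Vertex d))} {σ σ' : Sym2 (Vertex d) → Prop}
    (h : ConsistentOn κ U A σ) (h' : ConsistentOn κ U A' σ')
    (hA : ∀ e, IsNNEdge e → (e ∈ A ↔ e ∈ A') ∨ (¬ σ e ∧ e ∉ A')) :
    ∀ e, IsNNEdge e → (σ e ↔ σ' e) := fun e he =>
  h.congr_below hwf h' (U e + 1) (fun g hg _ => hA g hg) e he (by linarith)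

lemma ConsistentOn.degree_le {d κ : ℕ} {U : Config d}
    (hinj : ∀ e f, IsNNEdge e → IsNNEdge f → U e = U f → e = f)
    {A : Set (Sym2 (Vertex d))} {σ : Sym2 (Vertex d) → Prop} (h : ConsistentOn κ U A σ)
    (v : Vertex d) : Set.ncard {f | IsNNEdge f ∧ v ∈ f ∧ σ f} ≤ κ := by
  set X := {f | IsNNEdge f ∧ v ∈ f ∧ σ f} with hXdef
  have hX : X.Finite := (finite_incident v).subset fun f hf => ⟨hf.1, hf.2.1⟩
  rcases X.eq_empty_or_nonempty with h0 | hne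
  · simp [h0]
  · obtain ⟨f, hf, hmax⟩ := Set.exists_max_image X U hX hne
    have h1 := ((h f hf.1).1 hf.2.2).2 v hf.2.1
    have h2 : X \ {f} ⊆ {g | IsNNEdge g ∧ v ∈ g ∧ g ≠ f ∧ U g < U f ∧ σ g} := by
      rintro g ⟨hg, hgf⟩
      exact ⟨hg.1, hg.2.1, hgf, lt_of_le_of_ne (hmax g hg) fun h => hgf (hinj _ _ hg.1 hf.1 h),
        hg.2.2⟩
    have h3 := Set.ncard_le_ncard h2
      ((finite_incident v).subset fun g hg => ⟨hg.1, hg.2.1⟩)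
    have h4 := Set.ncard_sdiff_singleton_add_one hf hX
    omega

/-- Relabelling the edges of `S` (present exactly on `L ⊆ S`) has no effect outside `S`, provided
that no closed edge outside `S` touches a relevant edge of `S` and the resulting degrees are at
most `κ`. -/
lemma ConsistentOn.relabel {d κ : ℕ} {U V : Config d} {A A' S L : Set (Sym2 (Vertex d))}
    {σ : Sym2 (Vertex d) → Prop} (h : ConsistentOn κ U A σ) (hLS : L ⊆ S)
    (hV : ∀ e, e ∉ S → V e = U e) (hA : ∀ e, IsNNEdge e → e ∉ S → (e ∈ A' ↔ e ∈ A))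
    (hS : ∀ e, IsNNEdge e → e ∈ S → (e ∈ A' ↔ e ∈ L))
    (hclosed : ∀ e g, IsNNEdge e → IsNNEdge g → e ∉ S → e ∈ A → ¬ σ e → g ∈ S → near e g →
      ¬ σ g ∧ g ∉ L)
    (hdeg : ∀ v, Set.ncard {f | IsNNEdge f ∧ v ∈ f ∧ ((σ f ∧ f ∉ S) ∨ f ∈ L)} ≤ κ) :
    ConsistentOn κ V A' (fun e => (σ e ∧ e ∉ S) ∨ e ∈ L) := by
  have hopen : ∀ e, IsNNEdge e → ((σ e ∧ e ∉ S) ∨ e ∈ L) → ∀ v ∈ e,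
      Set.ncard {f | IsNNEdge f ∧ v ∈ f ∧ f ≠ e ∧ V f < V e ∧ ((σ f ∧ f ∉ S) ∨ f ∈ L)} < κ := by
    intro e he hρ v hv
    have hfin : {f | IsNNEdge f ∧ v ∈ f ∧ ((σ f ∧ f ∉ S) ∨ f ∈ L)}.Finite :=
      (finite_incident v).subset fun g hg => ⟨hg.1, hg.2.1⟩
    refine lt_of_lt_of_le (Set.ncard_lt_ncard ?_ hfin) (hdeg v)
    refine ⟨fun f hf => ⟨hf.1, hf.2.1, hf.2.2.2.2⟩, fun hsub => ?_⟩
    exact (hsub (show e ∈ _ from ⟨he, hv, hρ⟩)).2.2.1 rfl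
  intro e he
  constructor
  · intro hρ
    refine ⟨?_, hopen e he hρ⟩
    rcases hρ with ⟨h1, h2⟩ | h1
    · exact (hA e he h2).2 ((h e he).1 h1).1
    · exact (hS e he (hLS h1)).2 h1
  · rintro ⟨h1, h2⟩
    by_cases hes : e ∈ S
    · exact Or.inr ((hS e he hes).1 h1)
    · refine Or.inl ⟨?_, hes⟩
      by_contra hne
      have heA := (hA e he hes).1 h1
      refine hne ((h e he).2 ⟨heA, fun v hv => ?_⟩)
      have h3 := h2 v hv
      convert h3 using 2
      ext f
      refine and_congr_right fun hf => and_congr_right fun hvf => and_congr_right fun _ => ?_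
      by_cases hfS : f ∈ S
      · have := hclosed e f he hf hes heA hne hfS ⟨v, hv, hvf⟩
        simp [this.1, this.2]
      · have hfL : f ∉ L := fun h => hfS (hLS h)
        rw [hV f hfS, hV e hes]
        simp [hfS, hfL]

/-! ### The arm event for restricted dynamics -/

/-- `x 0, …, x k` with cut index `l` witnesses the modified one-arm event for the present edges
`A` and the open edges `σ`. -/
def ArmPath {d : ℕ} (n : ℕ) (U : Config d) (A : Set (Sym2 (Vertex d)))
    (σ : Sym2 (Vertex d) → Prop) (k : ℕ) (x : ℕ → Vertex d) (l : ℕ) : Prop :=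
  IsPathOn k x ∧ norm1 (x 0) = (n : ℤ) ∧ (∀ i, 1 ≤ i → i ≤ k → norm1 (x i) < (n : ℤ)) ∧
    x k = 0 ∧ l ≤ k ∧ (∀ i < l, σ s(x i, x (i + 1))) ∧
    (∀ i, l ≤ i → i < k → s(x i, x (i + 1)) ∈ A) ∧
    (∀ i, l ≤ i → i + 1 < k → U s(x (i + 1), x (i + 2)) < U s(x i, x (i + 1)))

/-- The modified one-arm event for the present edges `A` and the open edges `σ`. -/
def Arm {d : ℕ} (n : ℕ) (U : Config d) (A : Set (Sym2 (Vertex d)))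
    (σ : Sym2 (Vertex d) → Prop) : Prop :=
  ∃ k x l, ArmPath n U A σ k x l

lemma ArmPath.edge {d n : ℕ} {U : Config d} {A : Set (Sym2 (Vertex d))}
    {σ : Sym2 (Vertex d) → Prop} {k l : ℕ} {x : ℕ → Vertex d} (h : ArmPath n U A σ k x l)
    {i : ℕ} (hi : i < k) : IsNNEdge s(x i, x (i + 1)) :=
  isNNEdge_iff.2 (h.1.1 i hi)

lemma ArmPath.transfer {d n : ℕ} {U U' : Config d} {A A' : Set (Sym2 (Vertex d))}
    {σ σ' : Sym2 (Vertex d) → Prop} {k l : ℕ} {x : ℕ → Vertex d} (h : ArmPath n U A σ k x l)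
    (hσ : ∀ i < l, σ s(x i, x (i + 1)) → σ' s(x i, x (i + 1)))
    (hA : ∀ i, l ≤ i → i < k → s(x i, x (i + 1)) ∈ A → s(x i, x (i + 1)) ∈ A' ∧
      U' s(x i, x (i + 1)) = U s(x i, x (i + 1))) : ArmPath n U' A' σ' k x l := by
  obtain ⟨h1, h2, h3, h4, h5, h6, h7, h8⟩ := h
  refine ⟨h1, h2, h3, h4, h5, fun i hi => hσ i hi (h6 i hi),
    fun i hi hik => (hA i hi hik (h7 i hi hik)).1, fun i hi hik => ?_⟩
  have e1 := (hA i hi (by omega) (h7 i hi (by omega))).2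
  have e2 := (hA (i + 1) (by omega) (by omega) (h7 (i + 1) (by omega) (by omega))).2
  rw [e1, e2]
  exact h8 i hi hik

lemma Arm.mono {d n : ℕ} {U U' : Config d} {A A' : Set (Sym2 (Vertex d))}
    {σ σ' : Sym2 (Vertex d) → Prop} (h : Arm n U A σ) (hσ : ∀ e, IsNNEdge e → σ e → σ' e)
    (hA : ∀ e, IsNNEdge e → e ∈ A → e ∈ A' ∧ U' e = U e) : Arm n U' A' σ' := by
  obtain ⟨k, x, l, h⟩ := h
  have hlk := h.2.2.2.2.1
  exact ⟨k, x, l, h.transfer (fun i hi => hσ _ (h.edge (by omega)))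
    (fun i hi hik => hA _ (h.edge hik))⟩

lemma openEdge_iff {d κ : ℕ} {U : Config d} (hwf : WellFounded (prec U)) {p : ℝ}
    {σ : Sym2 (Vertex d) → Prop} (h : ConsistentOn κ U {e | U e ≤ p} σ) {e : Sym2 (Vertex d)}
    (he : IsNNEdge e) : openEdge κ U p e ↔ σ e := by
  have key : ∀ τ, Consistent κ U τ → U e ≤ p → (τ e ↔ σ e) := by
    intro τ hτ hep
    have h1 : ConsistentOn κ U Set.univ τ := fun e he => by simpa using hτ e he
    have h2 := h.congr_below hwf h1 (U e + 1)
    have h3 : ConsistentOn κ U {e | U e ≤ p} (fun e => U e ≤ p ∧ τ e) := by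
      intro f hf
      simp only [Set.mem_ofPred_eq]
      refine and_congr_right fun hfp => ?_
      rw [hτ f hf]
      refine forall₂_congr fun v hv => ?_
      have : {g | IsNNEdge g ∧ v ∈ g ∧ g ≠ f ∧ U g < U f ∧ τ g} =
          {g | IsNNEdge g ∧ v ∈ g ∧ g ≠ f ∧ U g < U f ∧ U g ≤ p ∧ τ g} := by
        ext g
        refine and_congr_right fun _ => and_congr_right fun _ => and_congr_right fun _ =>
          and_congr_right fun hlt => ?_
        exact (and_iff_right (hlt.le.trans hfp)).symm
      rw [this]
    have h4 := h3.congr hwf h (fun _ _ => Or.inl Iff.rfl) e he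
    simpa [hep] using h4
  constructor
  · rintro ⟨-, hep, τ, hτ, hτe⟩
    exact (key τ hτ hep).1 hτe
  · intro hσ
    obtain ⟨τ, hτ⟩ := exists_consistentOn κ hwf Set.univ
    have hτ' : Consistent κ U τ := fun e he => by simpa using hτ e he
    have hep : U e ≤ p := ((h e he).1 hσ).1
    exact ⟨he, hep, τ, hτ', (key τ hτ' hep).2 hσ⟩

lemma modifiedOneArm_iff {d κ n : ℕ} {U : Config d} (hwf : WellFounded (prec U)) {p : ℝ}
    {σ : Sym2 (Vertex d) → Prop} (h : ConsistentOn κ U {e | U e ≤ p} σ) :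
    modifiedOneArm κ n p U ↔ Arm n U {e | U e ≤ p} σ := by
  constructor
  · rintro ⟨k, x, h1, h2, h3, h4, l, h5, h6, h7, h8⟩
    exact ⟨k, x, l, h1, h2, h3, h4, h5, fun i hi => (openEdge_iff hwf h
      (isNNEdge_iff.2 (h1.1 i (by omega)))).1 (h6 i hi), h7, h8⟩
  · rintro ⟨k, x, l, h1, h2, h3, h4, h5, h6, h7, h8⟩
    exact ⟨k, x, h1, h2, h3, h4, l, h5, fun i hi => (openEdge_iff hwf h
      (isNNEdge_iff.2 (h1.1 i (by omega)))).2 (h6 i hi), h7, h8⟩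

/-- The edges meeting the open `ℓ^1` ball of radius `n`. -/
def ballEdges (d n : ℕ) : Set (Sym2 (Vertex d)) :=
  {f | IsNNEdge f ∧ ∃ v ∈ f, norm1 v < (n : ℤ)}

/-- Whatever the labels on `S`, as long as they are at most `p` on `L` and above `p` on the rest
of `S`, the edge `f` is `p`-pivotal. -/
def ForcesPivotal {d : ℕ} (κ n : ℕ) (p : ℝ) (W : Config d) (S L : Set (Sym2 (Vertex d)))
    (f : Sym2 (Vertex d)) : Prop :=
  ∀ V ∈ goodConfigs d, (∀ g, g ∉ S → V g = W g) → (∀ g ∈ L, V g ≤ p) →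
    (∀ g ∈ S, g ∉ L → p < V g) → Function.update V f p ∈ goodConfigs d → pPivotal κ n p f V

lemma forcesPivotal_of {d κ n : ℕ} {p : ℝ} {W : Config d} {A S L : Set (Sym2 (Vertex d))}
    {σ : Sym2 (Vertex d) → Prop} {f : Sym2 (Vertex d)} (h : ConsistentOn κ W A σ)
    (hLS : L ⊆ S) (hfS : f ∈ S) (hfL : f ∉ L)
    (hA : ∀ e, e ∉ S → (W e ≤ p ↔ e ∈ A))
    (hclosed : ∀ e g, IsNNEdge e → IsNNEdge g → e ∉ S → e ∈ A → ¬ σ e → g ∈ S → near e g →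
      ¬ σ g ∧ g ∉ insert f L)
    (hdeg : ∀ v, Set.ncard
      {g | IsNNEdge g ∧ v ∈ g ∧ ((σ g ∧ g ∉ S) ∨ g ∈ insert f L)} ≤ κ)
    (hpiv : ∀ V V' : Config d, (∀ g, g ∉ S → V g = W g) → (∀ g, g ∉ S → V' g = W g) →
      ¬ Arm n V ((A \ S) ∪ L) (fun e => (σ e ∧ e ∉ S) ∨ e ∈ L) ∧
      Arm n V' ((A \ S) ∪ insert f L) (fun e => (σ e ∧ e ∉ S) ∨ e ∈ insert f L)) :
    ForcesPivotal κ n p W S L f := by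
  intro V hV hVW hVL hVS hV'
  set V' := Function.update V f p with hV'def
  have hpf : p < V f := hVS f hfS hfL
  have hV'f : V' f = p := by simp [hV'def]
  have hV'ne : ∀ g, g ≠ f → V' g = V g := fun g hg => by simp [hV'def, hg]
  have hV'W : ∀ g, g ∉ S → V' g = W g := fun g hg => by
    rw [hV'ne g fun h => hg (h ▸ hfS), hVW g hg]
  have eq1 : {e | V e ≤ p} = (A \ S) ∪ L := by
    ext e
    by_cases heS : e ∈ S
    · by_cases heL : e ∈ L
      · simp [heL, hVL e heL]
      · simp [heL, heS, hVS e heS heL]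
    · have : e ∉ L := fun h => heS (hLS h)
      simp [heS, this, hVW e heS, hA e heS]
  have eq2 : {e | V' e ≤ p} = (A \ S) ∪ insert f L := by
    ext e
    by_cases hef : e = f
    · simp [hef, hV'f]
    · have := Set.ext_iff.1 eq1 e
      simpa [hef, hV'ne e hef] using this
  have hL'S : insert f L ⊆ S := Set.insert_subset hfS hLS
  have hfin : ∀ v, {g | IsNNEdge g ∧ v ∈ g ∧ ((σ g ∧ g ∉ S) ∨ g ∈ insert f L)}.Finite :=
    fun v => (finite_incident v).subset fun g hg => ⟨hg.1, hg.2.1⟩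
  have c1 : ConsistentOn κ V {e | V e ≤ p} (fun e => (σ e ∧ e ∉ S) ∨ e ∈ L) := by
    rw [eq1]
    refine h.relabel hLS hVW (fun e _ he => ?_) (fun e _ he => ?_)
      (fun e g he hg h1 h2 h3 h4 h5 => ?_) (fun v => ?_)
    · have : e ∉ L := fun h => he (hLS h)
      simp [he, this]
    · simp [he]
    · have := hclosed e g he hg h1 h2 h3 h4 h5
      exact ⟨this.1, fun h => this.2 (Set.mem_insert_of_mem _ h)⟩
    · refine le_trans (Set.ncard_le_ncard ?_ (hfin v)) (hdeg v)
      exact fun g hg => ⟨hg.1, hg.2.1, hg.2.2.imp_right (Set.mem_insert_of_mem _)⟩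
  have c2 : ConsistentOn κ V' {e | V' e ≤ p} (fun e => (σ e ∧ e ∉ S) ∨ e ∈ insert f L) := by
    rw [eq2]
    refine h.relabel hL'S hV'W (fun e _ he => ?_) (fun e _ he => ?_) hclosed hdeg
    · have : e ∉ insert f L := fun h => he (hL'S h)
      simp only [Set.mem_union, Set.mem_sdiff, he, this]
      simp
    · simp [he]
  refine ⟨hV, hpf, hV', fun hiff => ?_⟩
  rw [modifiedOneArm_iff (wellFounded_prec hV) c1, modifiedOneArm_iff (wellFounded_prec hV') c2,
    eq1, eq2] at hiff
  obtain ⟨h1, h2⟩ := hpiv V V' hVW hV'W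
  exact h1 (hiff.2 h2)

/-- The set of vertices of the tail of an arm path. -/
def tailVerts {d : ℕ} (k : ℕ) (x : ℕ → Vertex d) (l : ℕ) : Set (Vertex d) :=
  {v | ∃ j, l ≤ j ∧ j ≤ k ∧ x j = v}

/-- The edges to be resampled around the tail of an arm path. -/
def tailRegion {d : ℕ} (A : Set (Sym2 (Vertex d))) (σ : Sym2 (Vertex d) → Prop) (k : ℕ)
    (x : ℕ → Vertex d) (l : ℕ) : Set (Sym2 (Vertex d)) :=
  {g | IsNNEdge g ∧ ((∃ v ∈ tailVerts k x l, v ∈ g) ∨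
    (g ∈ A ∧ ¬ σ g ∧ ∃ h, IsNNEdge h ∧ near h g ∧ ∃ v ∈ tailVerts k x l, v ∈ h))}

/-- All the edges of an arm path from one step before the tail to one step before the end. -/
def tailOpen {d : ℕ} (k : ℕ) (x : ℕ → Vertex d) (l : ℕ) : Set (Sym2 (Vertex d)) :=
  {g | ∃ i, l ≤ i + 1 ∧ i + 1 < k ∧ s(x i, x (i + 1)) = g}

/-- If an arm path has a nonempty tail, its last edge can be made `p`-pivotal by resampling
around the tail. -/
lemma ArmPath.forcesPivotal {d κ n : ℕ} (hκ : 2 ≤ κ) (hn : 1 ≤ n) {p : ℝ} {W : Config d}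
    (hW : W ∈ goodConfigs d) {R : Set (Sym2 (Vertex d))} {σ : Sym2 (Vertex d) → Prop}
    {A : Set (Sym2 (Vertex d))} (hAR : A = {e | W e ≤ p} \ R)
    (h : ConsistentOn κ W A σ) {k l : ℕ} {x : ℕ → Vertex d}
    (hp : ArmPath n W A σ k x l) (hlk : l < k) :
    ForcesPivotal κ n p W (R ∪ tailRegion A σ k x l) (tailOpen k x l)
      s(x (k - 1), x k) ∧ tailOpen k x l ⊆ R ∪ tailRegion A σ k x l ∧
      s(x (k - 1), x k) ∉ tailOpen k x l := by
  obtain ⟨m, rfl⟩ : ∃ m, k = m + 1 := ⟨k - 1, by omega⟩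
  simp only [Nat.add_sub_cancel]
  set f := s(x m, x (m + 1)) with hf
  set S := R ∪ tailRegion A σ (m + 1) x l with hS
  set L := tailOpen (m + 1) x l with hL
  have hpath := hp.1
  have hinj := hp.1.2
  have hL' : ∀ g, g ∈ insert f L ↔ ∃ i, l ≤ i + 1 ∧ i ≤ m ∧ s(x i, x (i + 1)) = g := by
    intro g
    constructor
    · rintro (rfl | ⟨i, h1, h2, h3⟩)
      · exact ⟨m, by omega, le_rfl, rfl⟩
      · exact ⟨i, h1, by omega, h3⟩
    · rintro ⟨i, h1, h2, h3⟩
      by_cases him : i = m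
      · exact Or.inl (by rw [← h3, him])
      · exact Or.inr ⟨i, h1, by omega, h3⟩
  have htouch : ∀ g, IsNNEdge g → ∀ v ∈ tailVerts (m + 1) x l, v ∈ g → g ∈ S :=
    fun g hg v hv hvg => Or.inr ⟨hg, Or.inl ⟨v, hv, hvg⟩⟩
  have hL'T : ∀ g, g ∈ insert f L → IsNNEdge g ∧ ∃ v ∈ tailVerts (m + 1) x l, v ∈ g := by
    intro g hg
    obtain ⟨i, h1, h2, rfl⟩ := (hL' g).1 hg
    exact ⟨hp.edge (by omega), x (i + 1), ⟨i + 1, h1, by omega, rfl⟩, by simp⟩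
  have hL'S : ∀ g, g ∈ insert f L → g ∈ S := fun g hg => by
    obtain ⟨h1, v, hv, hvg⟩ := hL'T g hg
    exact htouch g h1 v hv hvg
  have hmem : ∀ i j, i ≤ m → j ≤ m + 1 → x j ∈ s(x i, x (i + 1)) → j = i ∨ j = i + 1 := by
    intro i j hi hj hji
    rcases Sym2.mem_iff.1 hji with h1 | h1
    · exact Or.inl (hinj _ hj _ (by omega) h1)
    · exact Or.inr (hinj _ hj _ (by omega) h1)
  have hfL : f ∉ L := by
    rintro ⟨i, h1, h2, h3⟩
    have h4 : x (m + 1) ∈ s(x i, x (i + 1)) := by rw [h3, hf]; simp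
    have := hmem i (m + 1) (by omega) le_rfl h4
    omega
  have hσR : ∀ g, IsNNEdge g → σ g → g ∉ R := fun g hg hσ hgR => by
    have := ((h g hg).1 hσ).1
    rw [hAR] at this
    exact this.2 hgR
  refine ⟨?_, fun g hg => hL'S g (Or.inr hg), hfL⟩
  refine forcesPivotal_of h (fun g hg => hL'S g (Or.inr hg)) (hL'S f (Or.inl rfl)) hfL
    (fun e he => ?_) (fun e g he hg heS heA hne hgS hnear => ?_) (fun v => ?_)
    (fun V V' hV hV' => ⟨?_, ?_⟩)
  · have : e ∉ R := fun h => he (Or.inl h)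
    simp [hAR, this]
  · constructor
    · intro hσg
      rcases hgS with hgR | ⟨-, hgT | ⟨-, h1, -⟩⟩
      · exact hσR g hg hσg hgR
      · exact heS (Or.inr ⟨he, Or.inr ⟨heA, hne, g, hg, near_comm hnear, hgT⟩⟩)
      · exact h1 hσg
    · intro hgL
      obtain ⟨-, hgT⟩ := hL'T g hgL
      exact heS (Or.inr ⟨he, Or.inr ⟨heA, hne, g, hg, near_comm hnear, hgT⟩⟩)
  · by_cases hv : v ∈ tailVerts (m + 1) x l
    · obtain ⟨j, hj1, hj2, rfl⟩ := hv
      refine le_trans ?_ hκ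
      refine (Set.ncard_le_ncard (t := {s(x (j - 1), x j), s(x j, x (j + 1))}) ?_).trans
        ((Set.ncard_insert_le _ _).trans (by simp))
      rintro g ⟨hg, hvg, ⟨-, hgS⟩ | hgL⟩
      · exact absurd (htouch g hg _ ⟨j, hj1, hj2, rfl⟩ hvg) hgS
      · obtain ⟨i, h1, h2, rfl⟩ := (hL' g).1 hgL
        rcases hmem i j h2 hj2 hvg with h3 | h3
        · subst h3; simp
        · subst h3; simp
    · refine (Set.ncard_le_ncard (fun g hg => ?_)
        ((finite_incident v).subset fun g hg => ⟨hg.1, hg.2.1⟩)).trans (h.degree_le hW.2.1 v)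
      obtain ⟨hg, hvg, ⟨hσ, -⟩ | hgL⟩ := hg
      · exact ⟨hg, hvg, hσ⟩
      · obtain ⟨i, h1, h2, rfl⟩ := (hL' g).1 hgL
        refine ⟨hg, hvg, hp.2.2.2.2.2.1 i ?_⟩
        by_contra hli
        rcases Sym2.mem_iff.1 hvg with rfl | rfl
        · exact hv ⟨i, by omega, by omega, rfl⟩
        · exact hv ⟨i + 1, by omega, by omega, rfl⟩
  · rintro ⟨k', x', l', hp'⟩
    have hk' : k' ≠ 0 := by
      rintro rfl
      have h1 := hp'.2.1
      rw [hp'.2.2.2.1] at h1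
      simp [norm1] at h1
      omega
    obtain ⟨m', rfl⟩ : ∃ m', k' = m' + 1 := ⟨k' - 1, by omega⟩
    have hg := hp'.edge (i := m') (by omega)
    have h0 : x (m + 1) ∈ s(x' m', x' (m' + 1)) := by
      rw [hp'.2.2.2.1, hp.2.2.2.1]; simp
    have hgS : s(x' m', x' (m' + 1)) ∈ S :=
      htouch _ hg _ ⟨m + 1, by omega, le_rfl, rfl⟩ h0
    have hgL : s(x' m', x' (m' + 1)) ∈ L := by
      by_cases hl' : m' < l'
      · rcases hp'.2.2.2.2.2.1 m' hl' with h1 | h1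
        · exact absurd hgS h1.2
        · exact h1
      · rcases hp'.2.2.2.2.2.2.1 m' (by omega) (by omega) with h1 | h1
        · exact absurd hgS h1.2
        · exact h1
    obtain ⟨i, h1, h2, h3⟩ := hgL
    rw [← h3] at h0
    have := hmem i (m + 1) (by omega) le_rfl h0
    omega
  · refine ⟨m + 1, x, m + 1, hpath, hp.2.1, hp.2.2.1, hp.2.2.2.1, le_rfl, fun i hi => ?_,
      fun i _ _ => by omega, fun i _ _ => by omega⟩
    by_cases hil : l ≤ i + 1
    · exact Or.inr ((hL' _).2 ⟨i, hil, by omega, rfl⟩)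
    · have hσ := hp.2.2.2.2.2.1 i (by omega)
      refine Or.inl ⟨hσ, ?_⟩
      rintro (hR | ⟨-, ⟨v, ⟨j, hj1, hj2, rfl⟩, hvg⟩ | ⟨-, h1, -⟩⟩)
      · exact hσR _ (hp.edge hi) hσ hR
      · have := hmem i j (by omega) hj2 hvg
        omega
      · exact h1 hσ

/-! ### From removal-pivotal edges to `p`-pivotal edges -/

/-- The open edges of the dynamics restricted to `A`. -/
noncomputable def openOn {d : ℕ} (κ : ℕ) (U : Config d) (A : Set (Sym2 (Vertex d))) :
    Sym2 (Vertex d) → Prop :=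
  Classical.epsilon (ConsistentOn κ U A)

lemma openOn_spec {d : ℕ} (κ : ℕ) {U : Config d} (hwf : WellFounded (prec U))
    (A : Set (Sym2 (Vertex d))) : ConsistentOn κ U A (openOn κ U A) :=
  Classical.epsilon_spec (exists_consistentOn κ hwf A)

/-- The outcome of the exploration started at `e` once the edges of `R` are removed: an edge `f`
can be made `p`-pivotal by resampling a neighbourhood of two monotone chains `T` and `γ`. -/
def Outcome {d : ℕ} (κ n : ℕ) (p : ℝ) (W : Config d) (R : Set (Sym2 (Vertex d)))
    (e : Sym2 (Vertex d)) : Prop :=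
  ∃ (f : Sym2 (Vertex d)) (T γ : List (Sym2 (Vertex d))) (S L : Set (Sym2 (Vertex d))),
    (ForcesPivotal κ n p W S L f ∧ L ⊆ S ∧ f ∈ S ∧ f ∉ L ∧ f ∈ ballEdges d n) ∧
    (T.head? = some f ∧ T.IsChain near ∧ T.Pairwise (fun a b => W a < W b)) ∧
    (γ.head? = some e ∧ γ.IsChain near ∧ γ.Pairwise (fun a b => W a < W b)) ∧
    (∃ a c, γ.getLast? = some a ∧ c ∈ T ∧ near c a) ∧
    (∀ g ∈ T ++ γ, IsNNEdge g ∧ g ∈ S) ∧ R ⊆ S ∧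
    ∀ g ∈ S, g ∈ R ∨ (IsNNEdge g ∧ ∃ h ∈ T ++ γ, ∃ h', IsNNEdge h' ∧ near h h' ∧ near h' g)

lemma ArmPath.tail_lt {d n : ℕ} {U : Config d} {A : Set (Sym2 (Vertex d))}
    {σ : Sym2 (Vertex d) → Prop} {k l : ℕ} {x : ℕ → Vertex d} (h : ArmPath n U A σ k x l)
    {i j : ℕ} (hli : l ≤ i) (hij : i < j) (hjk : j < k) :
    U s(x j, x (j + 1)) < U s(x i, x (i + 1)) := by
  induction j, hij using Nat.le_induction with
  | base => exact h.2.2.2.2.2.2.2 i hli hjk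
  | succ m hm ih =>
    exact (h.2.2.2.2.2.2.2 m (by omega) hjk).trans (ih (by omega))

lemma ArmPath.outcome {d κ n : ℕ} (hκ : 2 ≤ κ) (hn : 1 ≤ n) {p : ℝ} {W : Config d}
    (hW : W ∈ goodConfigs d) {R R' : Set (Sym2 (Vertex d))} {σ : Sym2 (Vertex d) → Prop}
    (h : ConsistentOn κ W ({e | W e ≤ p} \ R') σ) {k l : ℕ} {x : ℕ → Vertex d}
    (hp : ArmPath n W ({e | W e ≤ p} \ R') σ k x l) {j : ℕ} (hlj : l ≤ j) (hjk : j < k)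
    {e : Sym2 (Vertex d)} (he : IsNNEdge e) (hnear : near s(x j, x (j + 1)) e)
    (hRR' : R ⊆ R') (hR' : ∀ g ∈ R', g ∈ R ∨ (IsNNEdge g ∧ near e g)) :
    Outcome κ n p W R e := by
  obtain ⟨hF, hLS, hfL⟩ := hp.forcesPivotal hκ hn hW rfl h (by omega)
  set A := {e | W e ≤ p} \ R'
  obtain ⟨m, rfl⟩ : ∃ m, k = m + 1 := ⟨k - 1, by omega⟩
  simp only [Nat.add_sub_cancel] at hF hfL
  obtain ⟨q, rfl⟩ : ∃ q, m = l + q := ⟨m - l, by omega⟩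
  let t : ℕ → Sym2 (Vertex d) := fun i => s(x (l + q - i), x (l + q - i + 1))
  have hT : ∀ i, l ≤ i → i ≤ l + q → s(x i, x (i + 1)) ∈ (List.range (q + 1)).map t := by
    intro i h1 h2
    refine List.mem_map.2 ⟨l + q - i, List.mem_range.2 (by omega), ?_⟩
    have : l + q - (l + q - i) = i := by omega
    simp only [t, this]
  have hT' : ∀ g ∈ (List.range (q + 1)).map t, IsNNEdge g ∧
      ∃ v ∈ tailVerts (l + q + 1) x l, v ∈ g := by
    intro g hg
    obtain ⟨i, hi, rfl⟩ := List.mem_map.1 hg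
    rw [List.mem_range] at hi
    exact ⟨hp.edge (by omega), _, ⟨l + q - i, by omega, by omega, rfl⟩, by simp [t]⟩
  have hTv : ∀ v ∈ tailVerts (l + q + 1) x l, ∃ g ∈ (List.range (q + 1)).map t, v ∈ g := by
    rintro v ⟨i, h1, h2, rfl⟩
    by_cases hi : i = l + q + 1
    · exact ⟨_, hT (l + q) (by omega) le_rfl, by simp [hi]⟩
    · exact ⟨_, hT i h1 (by omega), by simp⟩
  have hfS : s(x (l + q), x (l + q + 1)) ∈ R' ∪ tailRegion A σ (l + q + 1) x l :=
    Or.inr ⟨hp.edge (by omega), Or.inl ⟨x (l + q), ⟨l + q, by omega, by omega, rfl⟩, by simp⟩⟩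
  refine ⟨_, (List.range (q + 1)).map t, [e], _, _, ⟨hF, hLS, hfS, hfL, hp.edge (by omega),
    x (l + q + 1), by simp, hp.2.2.1 _ (by omega) le_rfl⟩, ⟨?_, ?_, ?_⟩, ⟨rfl, by simp, by simp⟩,
    ⟨e, s(x j, x (j + 1)), rfl, hT j hlj (by omega), hnear⟩, fun g hg => ?_,
    hRR'.trans Set.subset_union_left, fun g hg => ?_⟩
  · simp [List.range_succ_eq_map, t]
  · rw [List.isChain_iff_getElem]
    intro i hi
    simp only [List.length_map, List.length_range] at hi
    simp only [List.getElem_map, List.getElem_range]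
    refine ⟨x (l + q - i), by simp [t], ?_⟩
    have : l + q - (i + 1) + 1 = l + q - i := by omega
    simp [t, this]
  · rw [List.pairwise_map]
    refine List.Pairwise.imp_of_mem ?_ List.pairwise_lt_range
    intro a b ha hb hab
    rw [List.mem_range] at ha hb
    exact hp.tail_lt (by omega) (by omega) (by omega)
  · rcases List.mem_append.1 hg with hg | hg
    · obtain ⟨h1, h2⟩ := hT' g hg
      exact ⟨h1, Or.inr ⟨h1, Or.inl h2⟩⟩
    · rw [List.mem_singleton] at hg
      subst hg
      obtain ⟨v, hv, hv'⟩ := hnear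
      refine ⟨he, Or.inr ⟨he, Or.inl ⟨v, ?_, hv'⟩⟩⟩
      rcases Sym2.mem_iff.1 hv with rfl | rfl
      · exact ⟨j, by omega, by omega, rfl⟩
      · exact ⟨j + 1, by omega, by omega, rfl⟩
  · rcases hg with hg | ⟨hg, ⟨v, hv, hvg⟩ | ⟨-, -, h', hh', hnear', v, hv, hvh⟩⟩
    · exact (hR' g hg).imp_right fun ⟨h1, h2⟩ => ⟨h1, e, by simp, e, he, near_refl e, h2⟩
    · obtain ⟨a, ha, hva⟩ := hTv v hv
      exact Or.inr ⟨hg, a, List.mem_append_left _ ha, a, (hT' a ha).1, near_refl a, v, hva, hvg⟩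
    · obtain ⟨a, ha, hva⟩ := hTv v hv
      exact Or.inr ⟨hg, a, List.mem_append_left _ ha, h', hh', ⟨v, hva, hvh⟩, hnear'⟩

/-- If removing a closed edge affects the arm event, then that edge lies on the tail of an arm
path. -/
lemma exists_tail_of_closed {d κ n : ℕ} {W : Config d} (hwf : WellFounded (prec W))
    {A : Set (Sym2 (Vertex d))} {σ σ' : Sym2 (Vertex d) → Prop} (h : ConsistentOn κ W A σ)
    {e : Sym2 (Vertex d)} (h' : ConsistentOn κ W (A \ {e}) σ')
    (hclosed : ¬ σ e) (hne : ¬ (Arm n W A σ ↔ Arm n W (A \ {e}) σ')) :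
    ∃ k x l j, ArmPath n W A σ k x l ∧ l ≤ j ∧ j < k ∧ s(x j, x (j + 1)) = e := by
  have hσ := h.congr hwf h' (fun g _ => by
    by_cases hge : g = e
    · exact Or.inr ⟨hge ▸ hclosed, by simp [hge]⟩
    · exact Or.inl (by simp [hge]))
  have h1 : Arm n W (A \ {e}) σ' → Arm n W A σ := fun H =>
    H.mono (fun g hg => (hσ g hg).2) (fun g _ hg => ⟨hg.1, rfl⟩)
  have h2 : Arm n W A σ := by tauto
  obtain ⟨k, x, l, hp⟩ := h2
  have hlk := hp.2.2.2.2.1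
  by_contra! hc
  refine hne (iff_of_true ⟨k, x, l, hp⟩ ⟨k, x, l, hp.transfer
    (fun i hi => (hσ _ (hp.edge (by omega))).1) fun i hi hik hA => ⟨⟨hA, ?_⟩, rfl⟩⟩)
  exact hc k x l i hp hi hik

lemma exists_insert_ne {α : Type*} (Φ : Set α → Prop) (A : Set α) {N : Set α} (hN : N.Finite)
    (h : ¬ (Φ A ↔ Φ (A ∪ N))) :
    ∃ N' ⊆ N, ∃ a ∈ N, a ∉ N' ∧ ¬ (Φ (A ∪ N') ↔ Φ (A ∪ insert a N')) := by
  induction N, hN using Set.Finite.induction_on with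
  | empty => simp at h
  | @insert a N ha _ ih =>
    by_cases h1 : Φ A ↔ Φ (A ∪ N)
    · exact ⟨N, Set.subset_insert _ _, a, Set.mem_insert _ _, ha, by rwa [h1] at h⟩
    · obtain ⟨N', h2, b, h3, h4⟩ := ih h1
      exact ⟨N', h2.trans (Set.subset_insert _ _), b, Set.mem_insert_of_mem _ h3, h4⟩

theorem outcome_of_removal {d κ n : ℕ} (hκ : 2 ≤ κ) (hn : 1 ≤ n) {p : ℝ} {W : Config d}
    (hW : W ∈ goodConfigs d) (e : Sym2 (Vertex d)) (he : IsNNEdge e) :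
    ∀ R : Set (Sym2 (Vertex d)), e ∉ R → W e ≤ p →
      ¬ (Arm n W ({g | W g ≤ p} \ R) (openOn κ W ({g | W g ≤ p} \ R)) ↔
        Arm n W ({g | W g ≤ p} \ insert e R) (openOn κ W ({g | W g ≤ p} \ insert e R))) →
      Outcome κ n p W R e := by
  have hwf := wellFounded_prec hW
  induction e using (wellFounded_prec_neg hW).induction with
  | _ e ih =>
    intro R heR hep hne
    let Φ : Set (Sym2 (Vertex d)) → Prop := fun R =>
      Arm n W ({g | W g ≤ p} \ R) (openOn κ W ({g | W g ≤ p} \ R))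
    have hspec : ∀ R, ConsistentOn κ W ({g | W g ≤ p} \ R)
        (openOn κ W ({g | W g ≤ p} \ R)) := fun R => openOn_spec κ hwf _
    set σ := openOn κ W ({g | W g ≤ p} \ R) with hσdef
    have hσ : ConsistentOn κ W ({g | W g ≤ p} \ R) σ := hspec R
    have hdiff : ∀ (R : Set (Sym2 (Vertex d))) (a : Sym2 (Vertex d)),
        ({g | W g ≤ p} \ insert a R) = ({g | W g ≤ p} \ R) \ {a} := by
      intro R a
      ext g
      simp only [Set.mem_sdiff, Set.mem_insert_iff, Set.mem_singleton_iff]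
      tauto
    -- removal of a closed edge near `e`
    have hclosedcase : ∀ R' a, near a e → R ⊆ R' →
        (∀ g ∈ R', g ∈ R ∨ (IsNNEdge g ∧ near e g)) →
        ¬ openOn κ W ({g | W g ≤ p} \ R') a → ¬ (Φ R' ↔ Φ (insert a R')) →
        Outcome κ n p W R e := by
      intro R' a hae hRR' hR' ha hΦ
      have h' := hspec (insert a R')
      simp only [Φ] at hΦ
      rw [hdiff] at hΦ h'
      obtain ⟨k, x, l, j, hp, hlj, hjk, hj⟩ := exists_tail_of_closed hwf (hspec R') h' ha hΦ
      exact hp.outcome hκ hn hW (hspec R') hlj hjk he (by rwa [hj]) hRR' hR'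
    let N : Set (Sym2 (Vertex d)) :=
      {g | IsNNEdge g ∧ near e g ∧ g ≠ e ∧ W g ≤ p ∧ g ∉ R ∧ ¬ σ g}
    have hNfin : N.Finite := (finite_near e).subset fun g hg => ⟨hg.1, hg.2.1⟩
    -- removing closed neighbours does not change the open edges
    have hcongr : ∀ N' ⊆ N, ∀ g, IsNNEdge g →
        (σ g ↔ openOn κ W ({g | W g ≤ p} \ (R ∪ N')) g) := by
      intro N' hN'
      refine hσ.congr hwf (hspec _) fun g _ => ?_
      by_cases hg : g ∈ N'
      · exact Or.inr ⟨(hN' hg).2.2.2.2.2, by simp [hg]⟩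
      · exact Or.inl (by simp [hg])
    by_cases h1 : Φ R ↔ Φ (R ∪ N)
    swap
    · obtain ⟨N', hN', a, ha, -, hΦ⟩ := exists_insert_ne Φ R hNfin h1
      rw [Set.union_insert] at hΦ
      refine hclosedcase (R ∪ N') a (near_comm ha.2.1) Set.subset_union_left ?_ ?_ hΦ
      · rintro g (hg | hg)
        · exact Or.inl hg
        · exact Or.inr ⟨(hN' hg).1, (hN' hg).2.1⟩
      · rw [← hcongr N' hN' a ha.1]
        exact ha.2.2.2.2.2
    by_cases h2 : Φ (R ∪ N) ↔ Φ (insert e (R ∪ N))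
    swap
    · have hR'sub : ∀ g ∈ R ∪ N, g ∈ R ∨ (IsNNEdge g ∧ near e g) := by
        rintro g (hg | hg)
        · exact Or.inl hg
        · exact Or.inr ⟨hg.1, hg.2.1⟩
      have hcN := hcongr N subset_rfl
      set σ' := openOn κ W ({g | W g ≤ p} \ (R ∪ N)) with hσ'def
      have hσ' : ConsistentOn κ W ({g | W g ≤ p} \ (R ∪ N)) σ' := hspec _
      by_cases hopen : σ' e
      swap
      · exact hclosedcase (R ∪ N) e (near_refl e) Set.subset_union_left hR'sub hopen h2
      set A := {g | W g ≤ p} \ (R ∪ N) with hAdef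
      have heN : e ∉ N := fun h => h.2.2.1 rfl
      have hσA : ∀ g, IsNNEdge g → σ' g → g ∈ A := fun g hg h => ((hσ' g hg).1 h).1
      have hcl : ∀ a g, IsNNEdge a → IsNNEdge g → a ≠ e → a ∈ A → ¬ σ' a → near a g →
          g ≠ e := by
        rintro a g ha hg hae haA hna hag rfl
        have h3 : W a ≤ p ∧ a ∉ R ∪ N := haA
        refine h3.2 (Or.inr ⟨ha, near_comm hag, hae, h3.1, fun h => h3.2 (Or.inl h), ?_⟩)
        rwa [hcN a ha]
      have hρ : ConsistentOn κ W (A \ {e}) (fun g => (σ' g ∧ g ∉ ({e} : Set _)) ∨ g ∈ (∅ : Set _)) := by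
        refine hσ'.relabel (Set.empty_subset _) (fun _ _ => rfl) (fun g _ hg => ?_)
          (fun g _ hg => ?_) (fun a g ha hg hae haA hna hgS hag => ?_) (fun v => ?_)
        · simp only [Set.mem_sdiff]
          tauto
        · simp only [Set.mem_sdiff, Set.mem_empty_iff_false]
          tauto
        · exact absurd hgS (hcl a g ha hg hae haA hna hag)
        · refine (Set.ncard_le_ncard ?_ ((finite_incident v).subset
            fun g hg => ⟨hg.1, hg.2.1⟩)).trans (hσ'.degree_le hW.2.1 v)
          exact fun g hg => ⟨hg.1, hg.2.1, by simpa using (hg.2.2.resolve_right (by simp)).1⟩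
      have hρ' := hspec (insert e (R ∪ N))
      simp only [Φ] at h2
      rw [hdiff] at h2 hρ'
      have hρeq := hρ.congr hwf hρ' (fun _ _ => Or.inl Iff.rfl)
      have hArmρ : Arm n W (A \ {e}) (openOn κ W (A \ {e})) ↔
          Arm n W (A \ {e}) (fun g => (σ' g ∧ g ∉ ({e} : Set _)) ∨ g ∈ (∅ : Set _)) :=
        ⟨fun H => H.mono (fun g hg => (hρeq g hg).2) (fun g _ hg => ⟨hg, rfl⟩),
          fun H => H.mono (fun g hg => (hρeq g hg).1) (fun g _ hg => ⟨hg, rfl⟩)⟩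
      rw [hArmρ] at h2
      have hmono : Arm n W (A \ {e}) (fun g => (σ' g ∧ g ∉ ({e} : Set _)) ∨ g ∈ (∅ : Set _)) →
          Arm n W A σ' := fun H =>
        H.mono (fun g _ hg => (hg.resolve_right (by simp)).1) (fun g _ hg => ⟨hg.1, rfl⟩)
      have harm : Arm n W A σ' := by tauto
      have hnarm : ¬ Arm n W (A \ {e})
        (fun g => (σ' g ∧ g ∉ ({e} : Set _)) ∨ g ∈ (∅ : Set _)) := by tauto
      obtain ⟨k, x, l, hp⟩ := harm
      have hlk := hp.2.2.2.2.1
      by_cases htail : ∃ j, l ≤ j ∧ j < k ∧ s(x j, x (j + 1)) = e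
      · obtain ⟨j, hlj, hjk, hj⟩ := htail
        exact hp.outcome hκ hn hW hσ' hlj hjk he (by rw [hj]; exact near_refl e)
          Set.subset_union_left hR'sub
      push Not at htail
      have hball : e ∈ ballEdges d n := by
        by_contra hb
        refine hnarm ⟨k, x, l, hp.transfer (fun i hi hi' => Or.inl ⟨hi', ?_⟩)
          fun i hi hik hA => ⟨⟨hA, htail i hi hik⟩, rfl⟩⟩
        rintro (h : s(x i, x (i + 1)) = e)
        exact hb ⟨he, x (i + 1), by simp [← h], hp.2.2.1 _ (by omega) (by omega)⟩
      have hAS : ∀ g, g ∈ A → g ≠ e → g ∉ insert e (R ∪ N) := by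
        rintro g hgA hge (h | h)
        · exact hge h
        · exact hgA.2 h
      have hF : ForcesPivotal κ n p W (insert e (R ∪ N)) ∅ e := by
        refine forcesPivotal_of hσ' (Set.empty_subset _) (Set.mem_insert _ _) (by simp)
          (fun g hg => ?_) (fun a g ha hg haS haA hna hgS hag => ?_) (fun v => ?_)
          (fun V V' hV hV' => ⟨fun H => hnarm ?_, ?_⟩)
        · have : g ∉ R ∪ N := fun h => hg (Or.inr h)
          simp [hAdef, this]
        · have hae : a ≠ e := fun h => haS (Or.inl h)
          have hge := hcl a g ha hg hae haA hna hag
          refine ⟨fun h => ?_, by simpa using hge⟩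
          exact hAS g (hσA g hg h) hge hgS
        · refine (Set.ncard_le_ncard ?_ ((finite_incident v).subset
            fun g hg => ⟨hg.1, hg.2.1⟩)).trans (hσ'.degree_le hW.2.1 v)
          rintro g ⟨hg, hvg, ⟨h, -⟩ | h⟩
          · exact ⟨hg, hvg, h⟩
          · have : g = e := by simpa using h
            exact ⟨hg, hvg, this ▸ hopen⟩
        · refine H.mono (fun g _ hg => ?_) (fun g _ hg => ?_)
          · have h3 := hg.resolve_right (by simp)
            exact Or.inl ⟨h3.1, fun h => h3.2 (Or.inl h)⟩
          · have h3 := hg.resolve_right (by simp)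
            exact ⟨⟨h3.1, fun h => h3.2 (Or.inl h)⟩, (hV g h3.2).symm⟩
        · refine ⟨k, x, l, hp.transfer (fun i hi hi' => ?_) fun i hi hik hA => ?_⟩
          · by_cases hie : s(x i, x (i + 1)) = e
            · exact Or.inr (by simp [hie])
            · exact Or.inl ⟨hi', hAS _ (hσA _ (hp.edge (by omega)) hi') hie⟩
          · have := hAS _ hA (htail i hi hik)
            exact ⟨Or.inl ⟨hA, this⟩, hV' _ this⟩
      refine ⟨e, [e], [e], _, _, ⟨hF, Set.empty_subset _, Set.mem_insert _ _, by simp, hball⟩,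
        ⟨rfl, by simp, by simp⟩, ⟨rfl, by simp, by simp⟩, ⟨e, e, rfl, by simp, near_refl e⟩,
        fun g hg => ?_, fun g hg => Or.inr (Or.inl hg), fun g hg => ?_⟩
      · have : g = e := by simpa using hg
        rw [this]
        exact ⟨he, Set.mem_insert _ _⟩
      · rcases hg with hge | hg
        · have hge' : g = e := hge
          rw [hge']
          exact Or.inr ⟨he, e, by simp, e, he, near_refl e, near_refl e⟩
        · exact (hR'sub g hg).imp_right fun ⟨h3, h4⟩ => ⟨h3, e, by simp, e, he, near_refl e, h4⟩
    -- the influence propagates to a later neighbour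
    have h3 : ¬ (Φ (insert e R) ↔ Φ (insert e R ∪ N)) := by
      rw [Set.insert_union]
      intro h
      exact hne ((h1.trans h2).trans h.symm)
    obtain ⟨N', hN', a, ha, haN', hΦ⟩ := exists_insert_ne Φ _ hNfin h3
    rw [Set.union_insert] at hΦ
    have hR'sub : ∀ g ∈ insert e R ∪ N', g ∈ R ∨ (IsNNEdge g ∧ near e g) := by
      rintro g ((hge | hg) | hg)
      · have hge' : g = e := hge
        rw [hge']
        exact Or.inr ⟨he, near_refl e⟩
      · exact Or.inl hg
      · exact Or.inr ⟨(hN' hg).1, (hN' hg).2.1⟩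
    have hRR' : R ⊆ insert e R ∪ N' := fun g hg => Or.inl (Or.inr hg)
    by_cases hopen : openOn κ W ({g | W g ≤ p} \ (insert e R ∪ N')) a
    swap
    · exact hclosedcase _ a (near_comm ha.2.1) hRR' hR'sub hopen hΦ
    obtain ⟨ha1, ha2, ha3, ha4, ha5, ha6⟩ := ha
    have hlt : W e < W a := by
      by_contra hle
      have hlt : W a < W e := lt_of_le_of_ne (not_lt.1 hle) fun h => ha3 (hW.2.1 _ _ ha1 he h)
      refine ha6 ((hσ.congr_below hwf (hspec _) (W e) (fun g _ hg => ?_) a ha1 hlt).2 hopen)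
      have hge : g ≠ e := fun h => by simp [h] at hg
      by_cases hgN : g ∈ N'
      · exact Or.inr ⟨(hN' hgN).2.2.2.2.2, by simp [hgN]⟩
      · exact Or.inl (by simp [hgN, hge])
    obtain ⟨f, T, γ, S, L, hcert, hT, ⟨hγ1, hγ2, hγ3⟩, ⟨b, c, hb, hc, hcb⟩, hmem, hRS, hS⟩ :=
      ih a ⟨ha1, he, near_comm ha2, neg_lt_neg hlt⟩ ha1 (insert e R ∪ N')
        (by
          rintro ((rfl | h) | h)
          · exact ha3 rfl
          · exact ha5 h
          · exact haN' h) ha4 hΦ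
    obtain ⟨γ', rfl⟩ : ∃ γ', γ = a :: γ' := by
      cases γ with
      | nil => simp at hγ1
      | cons y γ' => exact ⟨γ', by simp at hγ1; rw [hγ1]⟩
    refine ⟨f, T, e :: a :: γ', S, L, hcert, hT, ⟨rfl, ?_, ?_⟩, ⟨b, c, ?_, hc, hcb⟩,
      fun g hg => ?_, hRR'.trans hRS, fun g hg => ?_⟩
    · exact List.isChain_cons_cons.2 ⟨ha2, hγ2⟩
    · refine List.pairwise_cons.2 ⟨fun y hy => ?_, hγ3⟩
      rcases List.mem_cons.1 hy with rfl | hy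
      · exact hlt
      · exact hlt.trans ((List.pairwise_cons.1 hγ3).1 y hy)
    · rw [← hb]; simp [List.getLast?_cons]
    · rcases List.mem_append.1 hg with hg | hg
      · exact hmem g (List.mem_append_left _ hg)
      · rcases List.mem_cons.1 hg with rfl | hg
        · exact ⟨he, hRS (Or.inl (Or.inl rfl))⟩
        · exact hmem g (List.mem_append_right _ hg)
    · rcases hS g hg with h | ⟨h4, y, hy, h5⟩
      · exact (hR'sub g h).imp_right fun ⟨h5, h6⟩ => ⟨h5, e, by simp, e, he, near_refl e, h6⟩
      · refine Or.inr ⟨h4, y, ?_, h5⟩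
        rcases List.mem_append.1 hy with hy | hy
        · exact List.mem_append_left _ hy
        · exact List.mem_append_right _ (List.mem_cons_of_mem _ hy)

/-- A `U`-pivotal edge has an outcome, up to relabelling that edge. -/
theorem outcome_of_uPivotal {d κ n : ℕ} (hκ : 2 ≤ κ) (hn : 1 ≤ n) {p : ℝ} {U : Config d}
    {e : Sym2 (Vertex d)} (he : IsNNEdge e) (h : uPivotal κ n p e U) :
    ∃ W ∈ goodConfigs d, (∀ f, f ≠ e → W f = U f) ∧ Outcome κ n p W ∅ e := by
  obtain ⟨hU, U', hU', hUU', hne⟩ := h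
  have key : ∀ W ∈ goodConfigs d, ¬ Outcome κ n p W ∅ e →
      (modifiedOneArm κ n p W ↔
        Arm n W ({g | W g ≤ p} \ {e}) (openOn κ W ({g | W g ≤ p} \ {e}))) := by
    intro W hW hno
    have hwf := wellFounded_prec hW
    rw [modifiedOneArm_iff hwf (openOn_spec κ hwf _)]
    by_cases hep : W e ≤ p
    · by_contra hc
      refine hno (outcome_of_removal hκ hn hW e he ∅ (by simp) hep ?_)
      simpa using hc
    · have : {g | W g ≤ p} \ {e} = {g | W g ≤ p} := by
        refine Set.sdiff_singleton_eq_self ?_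
        exact hep
      rw [this]
  by_cases h1 : Outcome κ n p U ∅ e
  · exact ⟨U, hU, fun _ _ => rfl, h1⟩
  by_cases h2 : Outcome κ n p U' ∅ e
  · exact ⟨U', hU', hUU', h2⟩
  refine absurd ?_ hne
  rw [key U hU h1, key U' hU' h2]
  have hwf := wellFounded_prec hU
  have hwf' := wellFounded_prec hU'
  have hA : {g | U g ≤ p} \ {e} = {g | U' g ≤ p} \ {e} := by
    ext g
    by_cases hge : g = e
    · simp [hge]
    · simp [hge, hUU' g hge]
  have hσ := openOn_spec κ hwf ({g | U g ≤ p} \ {e})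
  have hσe : ¬ openOn κ U ({g | U g ≤ p} \ {e}) e := fun h => ((hσ e he).1 h).1.2 rfl
  have hρ : ConsistentOn κ U' ({g | U' g ≤ p} \ {e})
      (fun g => (openOn κ U ({g | U g ≤ p} \ {e}) g ∧ g ∉ ({e} : Set _)) ∨ g ∈ (∅ : Set _)) := by
    refine hσ.relabel (Set.empty_subset _) (fun g hg => hUU' g hg) (fun g _ hg => by rw [hA])
      (fun g _ hg => ?_) (fun a g ha hg hae haA hna hgS hag => ?_) (fun v => ?_)
    · simp only [Set.mem_sdiff, Set.mem_empty_iff_false]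
      tauto
    · have : g = e := hgS
      exact ⟨this ▸ hσe, by simp⟩
    · refine (Set.ncard_le_ncard ?_ ((finite_incident v).subset
        fun g hg => ⟨hg.1, hg.2.1⟩)).trans (hσ.degree_le hU.2.1 v)
      exact fun g hg => ⟨hg.1, hg.2.1, (hg.2.2.resolve_right (by simp)).1⟩
  have heq : ∀ g, IsNNEdge g → (openOn κ U ({g | U g ≤ p} \ {e}) g ↔
      openOn κ U' ({g | U' g ≤ p} \ {e}) g) := by
    intro g hg
    rw [← hρ.congr hwf' (openOn_spec κ hwf' _) (fun _ _ => Or.inl Iff.rfl) g hg]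
    by_cases hge : g = e
    · subst hge; simp [hσe]
    · simp [hge]
  constructor
  · intro H
    exact H.mono (fun g hg => (heq g hg).1) fun g _ hg => ⟨hA ▸ hg, hUU' g hg.2⟩
  · intro H
    exact H.mono (fun g hg => (heq g hg).2) fun g _ hg => ⟨hA.symm ▸ hg, (hUU' g hg.2).symm⟩

/-! ### Product measures -/

lemma IsProductUniform.eq_infinitePi {d : ℕ} {P : Measure (Config d)} (hP : IsProductUniform P) :
    P = Measure.infinitePi fun _ => volume.restrict (Set.Icc (0 : ℝ) 1) := by
  have : IsProbabilityMeasure (volume.restrict (Set.Icc (0 : ℝ) 1)) := ⟨by simp⟩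
  refine Measure.eq_infinitePi _ fun s t ht => ?_
  rw [show Set.pi s t = {U : Config d | ∀ e ∈ s, U e ∈ t e} from rfl, hP.2 s t fun e _ => ht e]
  exact Finset.prod_congr rfl fun e _ => (Measure.restrict_apply (ht e)).symm

/-- Events depending on disjoint sets of coordinates are independent, measurable or not. -/
lemma infinitePi_inter {E : Type*} (μ : Measure ℝ) [IsProbabilityMeasure μ] {S : Set E}
    {A M : Set (E → ℝ)} (hA : ∀ U V : E → ℝ, (∀ g, g ∉ S → V g = U g) → U ∈ A → V ∈ A)
    (hM : ∀ U V : E → ℝ, (∀ g ∈ S, V g = U g) → U ∈ M → V ∈ M) :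
    Measure.infinitePi (fun _ : E => μ) (A ∩ M) =
      Measure.infinitePi (fun _ : E => μ) A * Measure.infinitePi (fun _ : E => μ) M := by
  classical
  let φ := MeasurableEquiv.piEquivPiSubtypeProd (fun _ : E => ℝ) (· ∈ S)
  let ν₁ := Measure.infinitePi (fun _ : {g // g ∈ S} => μ)
  let ν₂ := Measure.infinitePi (fun _ : {g // g ∉ S} => μ)
  have hν : Measure.infinitePi (fun _ : E => μ) = (ν₁.prod ν₂).map φ.symm := by
    refine (Measure.eq_infinitePi _ fun s t ht => ?_).symm
    rw [MeasurableEquiv.map_apply]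
    have : φ.symm ⁻¹' Set.pi s t = (Set.pi (s.subtype (· ∈ S)) fun g => t g.1) ×ˢ
        (Set.pi (s.subtype (· ∉ S)) fun g => t g.1) := by
      ext x
      simp only [Set.mem_preimage, Set.mem_pi, Set.mem_prod, Finset.mem_coe, Finset.mem_subtype]
      constructor
      · intro h
        refine ⟨fun g hg => ?_, fun g hg => ?_⟩
        · simpa [φ, MeasurableEquiv.piEquivPiSubtypeProd, Equiv.piEquivPiSubtypeProd, g.2]
            using h g.1 hg
        · simpa [φ, MeasurableEquiv.piEquivPiSubtypeProd, Equiv.piEquivPiSubtypeProd, g.2]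
            using h g.1 hg
      · rintro ⟨h1, h2⟩ g hg
        by_cases hgS : g ∈ S
        · simpa [φ, MeasurableEquiv.piEquivPiSubtypeProd, Equiv.piEquivPiSubtypeProd, hgS]
            using h1 ⟨g, hgS⟩ hg
        · simpa [φ, MeasurableEquiv.piEquivPiSubtypeProd, Equiv.piEquivPiSubtypeProd, hgS]
            using h2 ⟨g, hgS⟩ hg
    rw [this, Measure.prod_prod, Measure.infinitePi_pi _ fun _ _ => ht _,
      Measure.infinitePi_pi _ fun _ _ => ht _, ← Finset.prod_filter_mul_prod_filter_not s (· ∈ S)]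
    congr 1
    · rw [← Finset.prod_subtype_eq_prod_filter]
    · rw [← Finset.prod_subtype_eq_prod_filter]
  have key : ∀ (a : Set ({g // g ∉ S} → ℝ)) (m : Set ({g // g ∈ S} → ℝ)),
      Measure.infinitePi (fun _ : E => μ) (φ ⁻¹' (m ×ˢ a)) = ν₁ m * ν₂ a := by
    intro a m
    rw [hν, MeasurableEquiv.map_apply, ← Set.preimage_comp]
    simp [Measure.prod_prod]
  let a : Set ({g // g ∉ S} → ℝ) := (fun U g => U g.1) '' A
  let m : Set ({g // g ∈ S} → ℝ) := (fun U g => U g.1) '' M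
  have hA' : A = φ ⁻¹' (Set.univ ×ˢ a) := by
    ext U
    refine ⟨fun h => ⟨trivial, U, h, rfl⟩, ?_⟩
    rintro ⟨-, V, hV, hVU⟩
    exact hA V U (fun g hg => (congrFun hVU ⟨g, hg⟩).symm) hV
  have hM' : M = φ ⁻¹' (m ×ˢ Set.univ) := by
    ext U
    refine ⟨fun h => ⟨⟨U, h, rfl⟩, trivial⟩, ?_⟩
    rintro ⟨⟨V, hV, hVU⟩, -⟩
    exact hM V U (fun g hg => (congrFun hVU ⟨g, hg⟩).symm) hV
  have hAM : A ∩ M = φ ⁻¹' (m ×ˢ a) := by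
    rw [hA', hM', ← Set.preimage_inter, Set.prod_inter_prod]
    simp
  rw [hAM, key]
  conv_rhs => rw [hA', hM', key, key]
  simp [ν₁, ν₂, mul_comm]

lemma infinitePi_strictMono_le {E : Type*} (μ : Measure ℝ) [IsProbabilityMeasure μ] {k : ℕ}
    {h : Fin k → E} (hh : Function.Injective h) :
    (k.factorial : ENNReal) *
      Measure.infinitePi (fun _ : E => μ) {U | StrictMono fun i => U (h i)} ≤ 1 := by
  have hmeas : ∀ τ : Fin k → Fin k,
      MeasurableSet {x : Fin k → ℝ | StrictMono fun i => x (τ i)} := by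
    intro τ
    have : {x : Fin k → ℝ | StrictMono fun i => x (τ i)} =
        ⋂ i, ⋂ j, ⋂ (_ : i < j), {x | x (τ i) < x (τ j)} := by
      ext x
      simp [StrictMono]
    rw [this]
    exact MeasurableSet.iInter fun i => MeasurableSet.iInter fun j => MeasurableSet.iInter fun _ =>
      measurableSet_lt (measurable_pi_apply _) (measurable_pi_apply _)
  have hmeas0 : MeasurableSet {x : Fin k → ℝ | StrictMono fun i => x i} := hmeas id
  let ν := Measure.infinitePi (fun _ : Fin k => μ)
  have h1 : Measure.infinitePi (fun _ : E => μ) {U | StrictMono fun i => U (h i)} =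
      ν {x | StrictMono fun i => x i} := by
    have := Measure.map_infinitePi_infinitePi_of_inj (P := fun _ : E => μ) hh
    rw [show ν = _ from this.symm, Measure.map_apply (by fun_prop) hmeas0]
    rfl
  have h2 : ∀ τ : Equiv.Perm (Fin k), ν {x | StrictMono fun i => x (τ i)} =
      ν {x | StrictMono fun i => x i} := by
    intro τ
    have := Measure.map_infinitePi_infinitePi_of_inj (P := fun _ : Fin k => μ) τ.injective
    conv_rhs => rw [show ν = _ from this.symm, Measure.map_apply (by fun_prop) hmeas0]
    rfl
  have hdisj : Pairwise (Function.onFun Disjoint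
      fun τ : Equiv.Perm (Fin k) => {x : Fin k → ℝ | StrictMono fun i => x (τ i)}) := by
    intro σ τ hne
    refine Set.disjoint_left.2 fun x hσ hτ => hne ?_
    have hr : Set.range (fun i => x (σ i)) = Set.range (fun i => x (τ i)) := by
      rw [show (fun i => x (σ i)) = x ∘ σ from rfl, show (fun i => x (τ i)) = x ∘ τ from rfl,
        σ.surjective.range_comp, τ.surjective.range_comp]
    have h3 := (StrictMono.range_inj hσ hτ).1 hr
    have hx : Function.Injective x := by
      intro i j hij
      have := @StrictMono.injective _ _ _ _ _ hσ (σ.symm i) (σ.symm j) (by simpa using hij)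
      simpa using this
    exact Equiv.ext fun i => hx (congrFun h3 i)
  calc (k.factorial : ENNReal) *
      Measure.infinitePi (fun _ : E => μ) {U | StrictMono fun i => U (h i)}
      = ∑ τ : Equiv.Perm (Fin k), ν {x | StrictMono fun i => x (τ i)} := by
        simp [h1, h2, Fintype.card_perm]
    _ = ν (⋃ τ : Equiv.Perm (Fin k), {x | StrictMono fun i => x (τ i)}) := by
        rw [measure_iUnion hdisj fun τ => hmeas τ, tsum_fintype]
    _ ≤ 1 := prob_le_one

/-- Monotonicity along a list is super-exponentially unlikely. -/
lemma infinitePi_pairwise_le {E : Type*} (μ : Measure ℝ) [IsProbabilityMeasure μ] {x : ℝ}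
    (hx : 0 < x) (l : List E) :
    Measure.infinitePi (fun _ : E => μ) {U | l.Pairwise fun a b => U a < U b} ≤
      ENNReal.ofReal (Real.exp x / x ^ l.length) := by
  by_cases hl : l.Nodup
  · have h1 := infinitePi_strictMono_le μ (h := l.get) (List.nodup_iff_injective_get.1 hl)
    have h2 : {U : E → ℝ | l.Pairwise fun a b => U a < U b} =
        {U | StrictMono fun i => U (l.get i)} := by
      ext U
      simp only [Set.mem_ofPred_eq, List.pairwise_iff_get]
      rfl
    rw [h2]
    have hfac : (0 : ℝ) < l.length.factorial := by positivity
    have h3 : (l.length.factorial : ENNReal) ≠ 0 := by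
      simpa using l.length.factorial_ne_zero
    have h4 : Measure.infinitePi (fun _ : E => μ) {U | StrictMono fun i => U (l.get i)} ≤
        (l.length.factorial : ENNReal)⁻¹ := by
      rw [← one_div, ENNReal.le_div_iff_mul_le (Or.inl h3) (Or.inl (ENNReal.natCast_ne_top _)),
        mul_comm]
      exact h1
    refine h4.trans ?_
    rw [← ENNReal.ofReal_natCast, ← ENNReal.ofReal_inv_of_pos hfac]
    refine ENNReal.ofReal_le_ofReal ?_
    have := Real.pow_div_factorial_le_exp x hx.le l.length
    rw [le_div_iff₀ (by positivity), inv_mul_eq_div]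
    exact this
  · have : {U : E → ℝ | l.Pairwise fun a b => U a < U b} = ∅ := by
      ext U
      simp only [Set.mem_ofPred_eq, Set.mem_empty_iff_false, iff_false]
      exact fun h => hl (h.imp fun hab he => by simp [he] at hab)
    simp [this]

/-! ### The cost of forcing a pivotal edge -/

/-- There is no infinite walk with strictly monotone labels. -/
def NoMonotoneWalk {d : ℕ} (U : Config d) : Prop :=
  ¬ ∃ w : ℕ → Vertex d, (∀ i, adj (w i) (w (i + 1))) ∧
    (StrictMono (fun i => U s(w i, w (i + 1))) ∨ StrictAnti (fun i => U s(w i, w (i + 1))))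

lemma NoMonotoneWalk.congr {d : ℕ} {U V : Config d} (hU : NoMonotoneWalk U)
    {S : Set (Sym2 (Vertex d))} (hS : S.Finite) (hV : ∀ g, g ∉ S → V g = U g) :
    NoMonotoneWalk V := by
  rintro ⟨w, hw, hmono⟩
  have hinj : Function.Injective fun i => s(w i, w (i + 1)) := by
    intro i j hij
    rcases hmono with h | h
    · exact h.injective (congrArg V hij)
    · exact h.injective (congrArg V hij)
  obtain ⟨N, hN⟩ := (hS.preimage hinj.injOn).bddAbove
  have hout : ∀ i, V s(w (N + 1 + i), w (N + 1 + i + 1)) =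
      U s(w (N + 1 + i), w (N + 1 + i + 1)) := by
    intro i
    refine hV _ fun h => ?_
    have : N + 1 + i ≤ N := hN h
    omega
  refine hU ⟨fun i => w (N + 1 + i), fun i => hw (N + 1 + i), ?_⟩
  rcases hmono with h | h
  · refine Or.inl fun i j hij => ?_
    have h1 : V s(w (N + 1 + i), w (N + 1 + i + 1)) < V s(w (N + 1 + j), w (N + 1 + j + 1)) :=
      h (show N + 1 + i < N + 1 + j by omega)
    rw [hout, hout] at h1
    exact h1
  · refine Or.inr fun i j hij => ?_
    have h1 : V s(w (N + 1 + j), w (N + 1 + j + 1)) < V s(w (N + 1 + i), w (N + 1 + i + 1)) :=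
      h (show N + 1 + i < N + 1 + j by omega)
    rw [hout, hout] at h1
    exact h1

/-- The uniform law on `[0,1]`. -/
noncomputable abbrev unif : Measure ℝ := volume.restrict (Set.Icc (0 : ℝ) 1)

instance : IsProbabilityMeasure unif := ⟨by simp⟩

/-- The law of i.i.d. uniform labels. -/
noncomputable abbrev law (d : ℕ) : Measure (Config d) := Measure.infinitePi fun _ => unif

lemma ae_mem_Icc (d : ℕ) : ∀ᵐ U ∂law d, ∀ e, U e ∈ Set.Icc (0 : ℝ) 1 := by
  refine ae_all_iff.2 fun e => ?_
  have h := (measurePreserving_eval_infinitePi (fun _ : Sym2 (Vertex d) => unif) e)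
  exact h.quasiMeasurePreserving.ae (ae_restrict_mem measurableSet_Icc)

lemma ae_ne_const (d : ℕ) (p : ℝ) : ∀ᵐ U ∂law d, ∀ e, U e ≠ p := by
  refine ae_all_iff.2 fun e => ?_
  have h := (measurePreserving_eval_infinitePi (fun _ : Sym2 (Vertex d) => unif) e)
  exact h.quasiMeasurePreserving.ae (p := fun x => x ≠ p) (Measure.ae_ne unif p)

lemma ae_injective (d : ℕ) : ∀ᵐ U ∂law d, ∀ e f, e ≠ f → U e ≠ U f := by
  refine ae_all_iff.2 fun e => ae_all_iff.2 fun f => ?_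
  by_cases hef : e = f
  · simp [hef]
  have h := Measure.infinitePi_map_eval_prod (P := fun _ : Sym2 (Vertex d) => unif) hef
  have h2 : ∀ᵐ x ∂unif.prod unif, x.1 ≠ x.2 := by
    have hm : MeasurableSet {x : ℝ × ℝ | x.1 ≠ x.2} :=
      (measurableSet_eq_fun measurable_fst measurable_snd).compl
    rw [Measure.ae_prod_iff_ae_ae hm]
    exact Filter.Eventually.of_forall fun x => (Measure.ae_ne unif x).mono fun y hy => hy.symm
  rw [← h] at h2
  exact (ae_of_ae_map (Measurable.aemeasurable (by fun_prop)) h2).mono fun U hU _ => hU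

lemma unif_Iic_ge {p : ℝ} (h1 : p ≤ 1) : ENNReal.ofReal p ≤ unif (Set.Iic p) := by
  rw [Measure.restrict_apply measurableSet_Iic]
  have : Set.Icc 0 p ⊆ Set.Iic p ∩ Set.Icc 0 1 := fun x hx => ⟨hx.2, hx.1, hx.2.trans h1⟩
  refine le_trans ?_ (measure_mono this)
  simp

lemma unif_Ioi_ge {p : ℝ} (h0 : 0 ≤ p) : ENNReal.ofReal (1 - p) ≤ unif (Set.Ioi p) := by
  rw [Measure.restrict_apply measurableSet_Ioi]
  have : Set.Ioc p 1 ⊆ Set.Ioi p ∩ Set.Icc 0 1 := fun x hx => ⟨hx.1, h0.trans hx.1.le, hx.2⟩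
  refine le_trans ?_ (measure_mono this)
  simp

lemma measure_forcesPivotal_le {d κ n : ℕ} {p c : ℝ} (hc : 0 < c) (hcp : c ≤ p)
    (hc1 : c ≤ 1 - p) {S L : Finset (Sym2 (Vertex d))} {f : Sym2 (Vertex d)} (hLS : L ⊆ S)
    {M : Set (Config d)} (hM : ∀ U V : Config d, (∀ g ∈ S, V g = U g) → U ∈ M → V ∈ M) :
    law d {U | (NoMonotoneWalk U ∧ ForcesPivotal κ n p U S L f) ∧ U ∈ M} ≤
      ENNReal.ofReal (c⁻¹ ^ S.card) * law d M * law d {U | pPivotal κ n p f U} := by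
  classical
  let A : Set (Config d) := {U | NoMonotoneWalk U ∧ ForcesPivotal κ n p U S L f}
  have hA : ∀ U V : Config d, (∀ g, g ∉ (S : Set (Sym2 (Vertex d))) → V g = U g) →
      U ∈ A → V ∈ A := by
    rintro U V hUV ⟨h1, h2⟩
    refine ⟨h1.congr S.finite_toSet hUV, fun V' hV' hVV' => h2 V' hV' fun g hg => ?_⟩
    rw [hVV' g hg, hUV g hg]
  let t : Sym2 (Vertex d) → Set ℝ := fun g => if g ∈ L then Set.Iic p else Set.Ioi p
  let Q : Set (Config d) := Set.pi S t
  have ht : ∀ g, MeasurableSet (t g) := by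
    intro g
    simp only [t]
    split_ifs
    · exact measurableSet_Iic
    · exact measurableSet_Ioi
  have hQ : ENNReal.ofReal (c ^ S.card) ≤ law d Q := by
    rw [Measure.infinitePi_pi _ fun g _ => ht g, ENNReal.ofReal_pow hc.le, ← Finset.prod_const]
    refine Finset.prod_le_prod' fun g _ => ?_
    simp only [t]
    split_ifs
    · exact (ENNReal.ofReal_le_ofReal hcp).trans (unif_Iic_ge (by linarith))
    · exact (ENNReal.ofReal_le_ofReal hc1).trans (unif_Ioi_ge (by linarith))
  have hAQ : law d (A ∩ Q) ≤ law d {U | pPivotal κ n p f U} := by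
    refine measure_mono_ae ?_
    filter_upwards [ae_mem_Icc d, ae_ne_const d p, ae_injective d] with U h1 h2 h3
    rintro ⟨⟨h4, h5⟩, h6⟩
    have hp : p ∈ Set.Icc (0 : ℝ) 1 := ⟨by linarith, by linarith⟩
    refine h5 U ⟨fun e _ => h1 e, fun e g _ _ h => by_contra fun hne => h3 e g hne h, h4⟩
      (fun _ _ => rfl) (fun g hg => ?_) (fun g hg hgL => ?_) ⟨fun e _ => ?_, fun e g _ _ h => ?_, ?_⟩
    · have := h6 g (hLS hg)
      simpa [t, Finset.mem_coe.1 hg] using this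
    · have := h6 g hg
      have hgL' : g ∉ L := hgL
      simpa [t, hgL'] using this
    · by_cases he : e = f
      · subst he; simpa using hp
      · simpa [he] using h1 e
    · by_contra hne
      by_cases he : e = f
      · subst he
        have hge : g ≠ e := fun h => hne h.symm
        simp only [Function.update_self, Function.update_of_ne hge] at h
        exact h2 g h.symm
      · by_cases hg : g = f
        · subst hg
          simp only [Function.update_self, Function.update_of_ne he] at h
          exact h2 e h
        · simp only [Function.update_of_ne hg, Function.update_of_ne he] at h
          exact h3 e g hne h
    · exact h4.congr (Set.finite_singleton f) fun g hg => Function.update_of_ne hg _ _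
  have hAQ' : law d (A ∩ Q) = law d A * law d Q :=
    infinitePi_inter unif hA fun U V hUV hU g hg => by rw [hUV g hg]; exact hU g hg
  have hAM : law d {U | (NoMonotoneWalk U ∧ ForcesPivotal κ n p U S L f) ∧ U ∈ M} =
      law d A * law d M := infinitePi_inter unif hA hM
  rw [hAM]
  have hcc : ENNReal.ofReal (c⁻¹ ^ S.card) * ENNReal.ofReal (c ^ S.card) = 1 := by
    rw [← ENNReal.ofReal_mul (by positivity), ← mul_pow, inv_mul_cancel₀ hc.ne']
    simp
  calc law d A * law d M
      = ENNReal.ofReal (c⁻¹ ^ S.card) * law d M *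
          (law d A * ENNReal.ofReal (c ^ S.card)) := by
        calc _ = (ENNReal.ofReal (c⁻¹ ^ S.card) * ENNReal.ofReal (c ^ S.card)) *
            (law d A * law d M) := by rw [hcc, one_mul]
          _ = _ := by ring
    _ ≤ ENNReal.ofReal (c⁻¹ ^ S.card) * law d M * (law d A * law d Q) := by gcongr
    _ ≤ _ := by rw [← hAQ']; gcongr

/-! ### Encoding of the certificates by words -/

/-- The walk of successively near edges described by a word, without its starting edge. -/
noncomputable def walkList {d : ℕ} (a : Sym2 (Vertex d)) :
    List (Fin d × Bool × Bool) → List (Sym2 (Vertex d))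
  | [] => []
  | i :: w => nb a i :: walkList (nb a i) w

lemma length_walkList {d : ℕ} (w : List (Fin d × Bool × Bool)) (a : Sym2 (Vertex d)) :
    (walkList a w).length = w.length := by
  induction w generalizing a with
  | nil => rfl
  | cons i w ih => simp [walkList, ih]

lemma exists_walkList {d : ℕ} (l : List (Sym2 (Vertex d))) (a : Sym2 (Vertex d))
    (h : (a :: l).IsChain near) (hl : ∀ g ∈ l, IsNNEdge g) : ∃ w, walkList a w = l := by
  induction l generalizing a with
  | nil => exact ⟨[], rfl⟩
  | cons b l ih =>
    rw [List.isChain_cons_cons] at h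
    obtain ⟨i, rfl⟩ := exists_nb (hl b (by simp)) h.1
    obtain ⟨w, hw⟩ := ih _ h.2 fun g hg => hl g (by simp [hg])
    exact ⟨i :: w, by simp [walkList, hw]⟩

/-- The last edge of the walk described by a word. -/
noncomputable def walkEnd {d : ℕ} (a : Sym2 (Vertex d)) (w : List (Fin d × Bool × Bool)) :
    Sym2 (Vertex d) :=
  (walkList a w).getLastD a

/-- The edges of the tripod from `f` described by three words. -/
noncomputable def tripod {d : ℕ} (f : Sym2 (Vertex d)) (u v w : List (Fin d × Bool × Bool)) :
    List (Sym2 (Vertex d)) :=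
  f :: (walkList f u ++ walkList (walkEnd f u) v ++ walkList (walkEnd f u) w)

lemma length_tripod {d : ℕ} (f : Sym2 (Vertex d)) (u v w : List (Fin d × Bool × Bool)) :
    (tripod f u v w).length = u.length + v.length + w.length + 1 := by
  simp [tripod, length_walkList]
  omega

open Classical in
/-- The edges within two steps of the tripod. -/
noncomputable def region {d : ℕ} (f : Sym2 (Vertex d)) (u v w : List (Fin d × Bool × Bool)) :
    Finset (Sym2 (Vertex d)) :=
  (tripod f u v w).toFinset.biUnion fun h =>
    Finset.univ.image fun i : (Fin d × Bool × Bool) × (Fin d × Bool × Bool) => nb (nb h i.1) i.2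

lemma card_region_le {d : ℕ} (f : Sym2 (Vertex d)) (u v w : List (Fin d × Bool × Bool)) :
    (region f u v w).card ≤ (u.length + v.length + w.length + 1) * (d * 4 * (d * 4)) := by
  classical
  refine (Finset.card_biUnion_le_card_mul _ _ (d * 4 * (d * 4)) fun h _ => ?_).trans ?_
  · refine Finset.card_image_le.trans ?_
    simp
  · gcongr
    rw [← length_tripod f u v w]
    exact List.toFinset_card_le _

open Classical in
/-- Off `e`, the labels are monotone along the legs of the tripod. -/
def LegsMonotone {d : ℕ} (f : Sym2 (Vertex d)) (u v w : List (Fin d × Bool × Bool))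
    (e : Sym2 (Vertex d)) (U : Config d) : Prop :=
  (((walkList f u).erase e).Pairwise fun a b => U a < U b) ∧
  (((walkList (walkEnd f u) v).erase e).Pairwise fun a b => U a < U b) ∧
  ((((walkList (walkEnd f u) w).reverse).erase e).Pairwise fun a b => U a < U b)

lemma LegsMonotone.congr {d : ℕ} {f e : Sym2 (Vertex d)} {u v w : List (Fin d × Bool × Bool)}
    {U V : Config d} (h : LegsMonotone f u v w e U) (hV : ∀ g ∈ tripod f u v w, V g = U g) :
    LegsMonotone f u v w e V := by
  classical
  have key : ∀ l : List (Sym2 (Vertex d)), (∀ g ∈ l, g ∈ tripod f u v w) →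
      ((l.erase e).Pairwise fun a b => U a < U b) → (l.erase e).Pairwise fun a b => V a < V b := by
    intro l hl hp
    refine hp.imp_of_mem fun ha hb hab => ?_
    rw [hV _ (hl _ (List.mem_of_mem_erase ha)), hV _ (hl _ (List.mem_of_mem_erase hb))]
    exact hab
  refine ⟨key _ (fun g hg => ?_) h.1, key _ (fun g hg => ?_) h.2.1, key _ (fun g hg => ?_) h.2.2⟩
  · simp [tripod, hg]
  · simp [tripod, hg]
  · simp [tripod, List.mem_reverse.1 hg]

lemma measure_legsMonotone_le {d : ℕ} {y : ℝ} (hy : 1 ≤ y) (f e : Sym2 (Vertex d))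
    (u v w : List (Fin d × Bool × Bool)) :
    law d {U | LegsMonotone f u v w e U} ≤
      ENNReal.ofReal (Real.exp (y ^ 3) * y ^ 3 * y⁻¹ ^ (u.length + v.length + w.length)) := by
  classical
  have hy3 : 1 ≤ y ^ 3 := one_le_pow₀ hy
  have key : ∀ l : List (Sym2 (Vertex d)), ∀ s : Set (Config d),
      (∀ U ∈ s, (l.erase e).Pairwise fun a b => U a < U b) →
      u.length + v.length + w.length ≤ 3 * l.length → law d s ≤
      ENNReal.ofReal (Real.exp (y ^ 3) * y ^ 3 * y⁻¹ ^ (u.length + v.length + w.length)) := by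
    intro l s hs hl
    refine (measure_mono hs).trans ((infinitePi_pairwise_le unif (by positivity : 0 < y ^ 3)
      (l.erase e)).trans (ENNReal.ofReal_le_ofReal ?_))
    rw [mul_assoc, div_eq_mul_inv]
    refine mul_le_mul_of_nonneg_left ?_ (Real.exp_pos _).le
    have h1 : l.length ≤ (l.erase e).length + 1 := by
      rw [List.length_erase]
      split_ifs <;> omega
    have h2 : y ^ (u.length + v.length + w.length) ≤ y ^ 3 * (y ^ 3) ^ (l.erase e).length := by
      rw [← pow_succ', ← pow_mul]
      exact pow_le_pow_right₀ hy (by omega)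
    rw [inv_pow, ← div_eq_mul_inv, le_div_iff₀ (by positivity), inv_mul_le_iff₀ (by positivity),
      mul_comm]
    exact h2
  rcases le_total u.length v.length with h1 | h1 <;>
  rcases le_total u.length w.length with h2 | h2 <;>
  rcases le_total v.length w.length with h3 | h3 <;>
  first
  | exact key (walkList f u) _ (fun U hU => hU.1) (by rw [length_walkList]; omega)
  | exact key (walkList (walkEnd f u) v) _ (fun U hU => hU.2.1) (by rw [length_walkList]; omega)
  | exact key (walkList (walkEnd f u) w).reverse _ (fun U hU => hU.2.2)
      (by rw [List.length_reverse, length_walkList]; omega)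

/-- The certificate event of a tripod. -/
def codeEvent {d : ℕ} (κ n : ℕ) (p : ℝ) (f : Sym2 (Vertex d))
    (u v w : List (Fin d × Bool × Bool)) (S L : Finset (Sym2 (Vertex d))) : Set (Config d) :=
  {U | L ⊆ S ∧ (∀ g ∈ tripod f u v w, g ∈ S) ∧
    (NoMonotoneWalk U ∧ ForcesPivotal κ n p U S L f) ∧
    LegsMonotone f u v w (walkEnd (walkEnd f u) w) U}

lemma pairwise_erase {d : ℕ} [DecidableEq (Sym2 (Vertex d))] {U W : Config d}
    {e : Sym2 (Vertex d)} (hWU : ∀ g, g ≠ e → W g = U g) {l : List (Sym2 (Vertex d))}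
    (h : l.Pairwise fun a b => W a < W b) : (l.erase e).Pairwise fun a b => U a < U b := by
  have hnd : l.Nodup := h.imp fun hab he => by simp [he] at hab
  refine (h.sublist List.erase_sublist).imp_of_mem fun ha hb hab => ?_
  rw [← hWU _ (hnd.mem_erase_iff.1 ha).1, ← hWU _ (hnd.mem_erase_iff.1 hb).1]
  exact hab

lemma exists_code {d κ n : ℕ} {p : ℝ} {U W : Config d} {e : Sym2 (Vertex d)}
    (hU : U ∈ goodConfigs d) (hWU : ∀ f, f ≠ e → W f = U f) (h : Outcome κ n p W ∅ e) :
    ∃ f ∈ ballEdges d n, ∃ u v w, walkEnd (walkEnd f u) w = e ∧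
      ∃ S ∈ (region f u v w).powerset, ∃ L ∈ (region f u v w).powerset,
        U ∈ codeEvent κ n p f u v w S L := by
  classical
  obtain ⟨f, T, γ, S, L, ⟨hF, hLS, hfS, -, hfb⟩, ⟨hT1, hT2, hT3⟩, ⟨hγ1, hγ2, hγ3⟩,
    ⟨a, c, ha, hcT, hca⟩, hmem, -, hS⟩ := h
  obtain ⟨s, t, rfl⟩ := List.append_of_mem hcT
  have hleg : ∃ l, s ++ [c] = f :: l ∧ l.getLastD f = c ∧ (f :: l).IsChain near := by
    cases s with
    | nil =>
      have : c = f := by simpa using hT1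
      exact ⟨[], by simp [this], by simp [this], by simp⟩
    | cons b s =>
      have : b = f := by simpa using hT1
      subst this
      refine ⟨s ++ [c], by simp, by simp [List.getLastD_eq_getLast?], ?_⟩
      rw [show b :: s ++ c :: t = (b :: (s ++ [c])) ++ t by simp] at hT2
      exact hT2.left_of_append
  obtain ⟨l, hl1, hl2, hl3⟩ := hleg
  have hTeq : s ++ c :: t = f :: (l ++ t) := by
    rw [show s ++ c :: t = (s ++ [c]) ++ t by simp, hl1]
    simp
  have hmemT : ∀ g, g = f ∨ g ∈ l ∨ g ∈ t → g ∈ s ++ c :: t := by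
    intro g hg
    rw [hTeq]
    simpa using hg
  obtain ⟨u, hu⟩ := exists_walkList l f hl3 fun g hg =>
    (hmem g (List.mem_append_left _ (hmemT g (by simp [hg])))).1
  have hc : walkEnd f u = c := by rw [walkEnd, hu, hl2]
  obtain ⟨v, hv⟩ := exists_walkList t c hT2.right_of_append fun g hg =>
    (hmem g (List.mem_append_left _ (hmemT g (by simp [hg])))).1
  obtain ⟨w, hw⟩ := exists_walkList γ.reverse c (by
      rw [List.isChain_cons]
      refine ⟨fun y hy => ?_, ?_⟩
      · rw [List.head?_reverse, ha] at hy
        obtain rfl : a = y := by simpa using hy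
        exact hca
      · rw [List.isChain_reverse]
        exact hγ2.imp fun _ _ h => near_comm h)
    fun g hg => (hmem g (List.mem_append_right _ (List.mem_reverse.1 hg))).1
  have he : walkEnd (walkEnd f u) w = e := by
    rw [hc, walkEnd, hw, List.getLastD_eq_getLast?, List.getLast?_reverse, hγ1]
    rfl
  have htri : ∀ g, g ∈ tripod f u v w ↔ g ∈ (s ++ c :: t) ++ γ := by
    intro g
    rw [tripod, hc, hu, hv, hw, hTeq]
    simp
  have hSB : S ⊆ region f u v w := by
    intro g hg
    obtain ⟨hgE, h, hh, h', hh', h1, h2⟩ := (hS g hg).resolve_left (by simp)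
    obtain ⟨i, rfl⟩ := exists_nb hh' h1
    obtain ⟨j, rfl⟩ := exists_nb hgE h2
    simp only [region, Finset.coe_biUnion, Set.mem_iUnion]
    exact ⟨h, by simpa using (htri h).2 hh, by
      simp only [Finset.coe_image, Finset.coe_univ, Set.image_univ]
      exact ⟨(i, j), rfl⟩⟩
  have hSfin : S.Finite := (region f u v w).finite_toSet.subset hSB
  have hLfin : L.Finite := hSfin.subset hLS
  refine ⟨f, hfb, u, v, w, he, hSfin.toFinset, ?_, hLfin.toFinset, ?_, ?_, ?_, ⟨hU.2.2, ?_⟩, ?_⟩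
  · simpa using hSB
  · simpa using hLS.trans hSB
  · simpa using hLS
  · intro g hg
    simpa using (hmem g ((htri g).1 hg)).2
  · rw [hSfin.coe_toFinset, hLfin.coe_toFinset]
    intro V hV hVU
    refine hF V hV fun g hg => ?_
    rw [hVU g hg, hWU]
    rintro rfl
    exact hg (hmem g (List.mem_append_right _ (List.mem_of_mem_head? hγ1))).2
  · rw [he]
    rw [hTeq] at hT3
    refine ⟨?_, ?_, ?_⟩
    · rw [hu]
      exact pairwise_erase hWU (hT3.sublist ((List.sublist_append_left l t).cons f))
    · rw [hc, hv]
      exact pairwise_erase hWU (hT3.sublist ((List.sublist_append_right l t).cons f))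
    · rw [hc, hw, List.reverse_reverse]
      exact pairwise_erase hWU hγ3

lemma measure_codeEvent_le {d κ n : ℕ} {p c y : ℝ} (hc : 0 < c) (hcp : c ≤ p) (hc1 : c ≤ 1 - p)
    (hy : 1 ≤ y) (f : Sym2 (Vertex d)) (u v w : List (Fin d × Bool × Bool))
    {S L : Finset (Sym2 (Vertex d))} (hS : S ⊆ region f u v w) :
    law d (codeEvent κ n p f u v w S L) ≤
      ENNReal.ofReal (c⁻¹ ^ (region f u v w).card *
        (Real.exp (y ^ 3) * y ^ 3 * y⁻¹ ^ (u.length + v.length + w.length))) *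
        law d {U | pPivotal κ n p f U} := by
  by_cases h : L ⊆ S ∧ ∀ g ∈ tripod f u v w, g ∈ S
  · refine (measure_mono (fun U hU => hU.2.2)).trans
      ((measure_forcesPivotal_le hc hcp hc1 h.1 (M := {U | LegsMonotone f u v w _ U})
        fun U V hUV hU => hU.congr fun g hg => hUV g (h.2 g hg)).trans ?_)
    gcongr
    rw [ENNReal.ofReal_mul (by positivity)]
    gcongr ?_ * ?_
    · refine ENNReal.ofReal_le_ofReal (pow_le_pow_right₀ ?_ (Finset.card_le_card hS))
      exact (one_le_inv₀ hc).2 (by linarith)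
    · exact measure_legsMonotone_le hy _ _ _ _ _
  · have : codeEvent κ n p f u v w S L = ∅ := by
      ext U
      simp only [Set.mem_empty_iff_false, iff_false]
      exact fun hU => h ⟨hU.1, hU.2.1⟩
    simp [this]

lemma measure_codeEvents_le {d κ n : ℕ} {p c y : ℝ} (hc : 0 < c) (hcp : c ≤ p) (hc1 : c ≤ 1 - p)
    (hy : 1 ≤ y) (f : Sym2 (Vertex d)) (u v w : List (Fin d × Bool × Bool)) :
    law d (⋃ S ∈ (region f u v w).powerset, ⋃ L ∈ (region f u v w).powerset,
        codeEvent κ n p f u v w S L) ≤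
      ENNReal.ofReal ((4 * c⁻¹) ^ ((u.length + v.length + w.length + 1) * (d * 4 * (d * 4))) *
        (Real.exp (y ^ 3) * y ^ 3 * y⁻¹ ^ (u.length + v.length + w.length))) *
        law d {U | pPivotal κ n p f U} := by
  set B := region f u v w with hB
  set X := Real.exp (y ^ 3) * y ^ 3 * y⁻¹ ^ (u.length + v.length + w.length) with hX
  have hX0 : 0 ≤ X := by positivity
  have h1 : law d (⋃ S ∈ B.powerset, ⋃ L ∈ B.powerset, codeEvent κ n p f u v w S L) ≤
      ∑ S ∈ B.powerset, ∑ L ∈ B.powerset, ENNReal.ofReal (c⁻¹ ^ B.card * X) *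
        law d {U | pPivotal κ n p f U} := by
    refine (measure_biUnion_finset_le _ _).trans (Finset.sum_le_sum fun S hS => ?_)
    refine (measure_biUnion_finset_le _ _).trans (Finset.sum_le_sum fun L _ => ?_)
    exact measure_codeEvent_le hc hcp hc1 hy f u v w (Finset.mem_powerset.1 hS)
  refine h1.trans ?_
  simp only [Finset.sum_const, Finset.card_powerset, nsmul_eq_mul]
  rw [← mul_assoc, ← mul_assoc]
  gcongr
  rw [← ENNReal.ofReal_natCast, ← ENNReal.ofReal_mul (by positivity),
    ← ENNReal.ofReal_mul (by positivity)]
  refine ENNReal.ofReal_le_ofReal ?_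
  have hc4 : 1 ≤ 4 * c⁻¹ := by
    have := (one_le_inv₀ hc).2 (by linarith)
    linarith
  calc _ = (4 * c⁻¹) ^ B.card * X := by
        push_cast
        rw [mul_pow, show (4 : ℝ) = 2 * 2 by norm_num, mul_pow]
        ring
    _ ≤ _ := by
        gcongr
        exact card_region_le f u v w

/-! ### Summation over the tripods -/

lemma finite_ballEdges (d n : ℕ) : (ballEdges d n).Finite := by
  have h : {v : Vertex d | norm1 v < (n : ℤ)}.Finite := by
    refine (Set.finite_Icc (fun _ => -(n : ℤ)) (fun _ => (n : ℤ))).subset fun v hv => ?_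
    have hi : ∀ i, |v i| ≤ n := fun i =>
      (Finset.single_le_sum (f := fun i => |v i|) (fun _ _ => abs_nonneg _)
        (Finset.mem_univ i)).trans (le_of_lt hv)
    exact ⟨fun i => (abs_le.1 (hi i)).1, fun i => (abs_le.1 (hi i)).2⟩
  refine (h.biUnion fun v _ => finite_incident v).subset ?_
  rintro g ⟨hg, v, hv, hvn⟩
  exact Set.mem_biUnion hvn ⟨hg, hv⟩

lemma tsum_prod_mul {α β : Type*} (a : α → ENNReal) (b : β → ENNReal) :
    ∑' q : α × β, a q.1 * b q.2 = (∑' i, a i) * ∑' j, b j := by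
  rw [ENNReal.tsum_prod (f := fun i j => a i * b j)]
  simp only [ENNReal.tsum_mul_left, ENNReal.tsum_mul_right]

lemma tsum_pow_length {ι : Type*} [Fintype ι] (r : ENNReal) :
    ∑' w : List ι, r ^ w.length = ∑' m : ℕ, (Fintype.card ι * r) ^ m := by
  rw [← (Equiv.sigmaFiberEquiv (List.length (α := ι))).tsum_eq, ENNReal.tsum_sigma']
  refine tsum_congr fun m => ?_
  have h : ∀ b : {w : List ι // w.length = m},
      r ^ ((Equiv.sigmaFiberEquiv (List.length (α := ι))) ⟨m, b⟩).length = r ^ m := by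
    intro b
    rw [show (Equiv.sigmaFiberEquiv (List.length (α := ι))) ⟨m, b⟩ = b.1 from rfl, b.2]
  simp only [h]
  have : Fintype {w : List ι // w.length = m} := inferInstanceAs (Fintype (List.Vector ι m))
  rw [tsum_fintype, Finset.sum_const, Finset.card_univ, mul_pow, nsmul_eq_mul]
  congr 1
  rw [show Fintype.card {w : List ι // w.length = m} = Fintype.card ι ^ m by
    rw [← card_vector (α := ι) m]
    exact Fintype.card_congr (Equiv.refl _)]
  push_cast
  rfl

lemma tsum_words {d : ℕ} (hd : 1 ≤ d) :
    ∑' w : List (Fin d × Bool × Bool), ENNReal.ofReal (1 / (8 * d)) ^ w.length = 2 := by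
  rw [tsum_pow_length, ← ENNReal.tsum_geometric_two]
  refine tsum_congr fun m => ?_
  congr 1
  have hd' : (0 : ℝ) < d := by exact_mod_cast hd
  rw [← ENNReal.ofReal_natCast, ← ENNReal.ofReal_mul (by positivity)]
  rw [show (2 : ENNReal)⁻¹ = ENNReal.ofReal 2⁻¹ by
    rw [ENNReal.ofReal_inv_of_pos (by norm_num)]; norm_num]
  congr 1
  simp only [Fintype.card_prod, Fintype.card_fin, Fintype.card_bool]
  push_cast
  field_simp
  norm_num

/-- The starting edges and words describing a tripod. -/
abbrev Code (d n : ℕ) : Type :=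
  ballEdges d n × List (Fin d × Bool × Bool) × List (Fin d × Bool × Bool) ×
    List (Fin d × Bool × Bool)

lemma tsum_uPivotal_le_tsum_code {d κ n : ℕ} (hκ : 2 ≤ κ) (hn : 1 ≤ n) (p : ℝ) :
    ∑' e : {e : Sym2 (Vertex d) // IsNNEdge e}, law d {U | uPivotal κ n p e.1 U} ≤
      ∑' q : Code d n, law d (⋃ S ∈ (region q.1.1 q.2.1 q.2.2.1 q.2.2.2).powerset,
        ⋃ L ∈ (region q.1.1 q.2.1 q.2.2.1 q.2.2.2).powerset,
          codeEvent κ n p q.1.1 q.2.1 q.2.2.1 q.2.2.2 S L) := by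
  classical
  set Z : Code d n → Set (Config d) := fun q =>
    ⋃ S ∈ (region q.1.1 q.2.1 q.2.2.1 q.2.2.2).powerset,
      ⋃ L ∈ (region q.1.1 q.2.1 q.2.2.1 q.2.2.2).powerset,
        codeEvent κ n p q.1.1 q.2.1 q.2.2.1 q.2.2.2 S L with hZ
  let lastEdge : Code d n → Sym2 (Vertex d) := fun q => walkEnd (walkEnd q.1.1 q.2.1) q.2.2.2
  have h1 : ∀ e : {e : Sym2 (Vertex d) // IsNNEdge e}, law d {U | uPivotal κ n p e.1 U} ≤
      ∑' q : Code d n, if e.1 = lastEdge q then law d (Z q) else 0 := by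
    intro e
    have hsub : {U | uPivotal κ n p e.1 U} ⊆ ⋃ q : Code d n, if e.1 = lastEdge q then Z q else ∅ := by
      intro U hU
      obtain ⟨W, -, hWU, hW⟩ := outcome_of_uPivotal hκ hn e.2 hU
      obtain ⟨f, hf, u, v, w, he, S, hS, L, hL, hSL⟩ := exists_code hU.1 hWU hW
      refine Set.mem_iUnion.2 ⟨(⟨f, hf⟩, u, v, w), ?_⟩
      rw [if_pos he.symm]
      exact Set.mem_biUnion hS (Set.mem_biUnion hL hSL)
    refine (measure_mono hsub).trans ((measure_iUnion_le _).trans (le_of_eq ?_))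
    refine tsum_congr fun q => ?_
    split_ifs <;> simp
  refine (ENNReal.tsum_le_tsum h1).trans ?_
  rw [ENNReal.tsum_comm]
  refine ENNReal.tsum_le_tsum fun q => ?_
  refine (ENNReal.tsum_comp_le_tsum_of_injective Subtype.val_injective
    (fun e => if e = lastEdge q then law d (Z q) else 0)).trans (le_of_eq ?_)
  exact tsum_ite_eq _ _

lemma tsum_uPivotal_le {d κ n : ℕ} (hd : 1 ≤ d) (hκ : 2 ≤ κ) (hn : 1 ≤ n) {p c : ℝ} (hc : 0 < c)
    (hcp : c ≤ p) (hc1 : c ≤ 1 - p) {Γ y : ℝ} (hΓ : Γ = (4 * c⁻¹) ^ (d * 4 * (d * 4)))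
    (hy : y = 8 * d * Γ) :
    ∑' e : {e : Sym2 (Vertex d) // IsNNEdge e}, law d {U | uPivotal κ n p e.1 U} ≤
      ENNReal.ofReal (Γ * (Real.exp (y ^ 3) * y ^ 3) * 8) *
        ∑' f : ballEdges d n, law d {U | pPivotal κ n p f.1 U} := by
  have hd' : (1 : ℝ) ≤ d := by exact_mod_cast hd
  have hc4 : 1 ≤ 4 * c⁻¹ := by
    have := (one_le_inv₀ hc).2 (by linarith)
    linarith
  have hΓ1 : 1 ≤ Γ := hΓ ▸ one_le_pow₀ hc4
  have hy1 : 1 ≤ y := by rw [hy]; nlinarith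
  have hΓy : Γ * y⁻¹ = 1 / (8 * d) := by
    rw [hy]
    field_simp
  set X := Γ * (Real.exp (y ^ 3) * y ^ 3) with hX
  have hX0 : 0 ≤ X := by positivity
  refine (tsum_uPivotal_le_tsum_code hκ hn p).trans ?_
  have h1 : ∀ q : Code d n, law d (⋃ S ∈ (region q.1.1 q.2.1 q.2.2.1 q.2.2.2).powerset,
      ⋃ L ∈ (region q.1.1 q.2.1 q.2.2.1 q.2.2.2).powerset,
        codeEvent κ n p q.1.1 q.2.1 q.2.2.1 q.2.2.2 S L) ≤
      ENNReal.ofReal X * (law d {U | pPivotal κ n p q.1.1 U} *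
        (ENNReal.ofReal (1 / (8 * d)) ^ q.2.1.length *
        (ENNReal.ofReal (1 / (8 * d)) ^ q.2.2.1.length *
        ENNReal.ofReal (1 / (8 * d)) ^ q.2.2.2.length))) := by
    rintro ⟨f, u, v, w⟩
    refine (measure_codeEvents_le hc hcp hc1 hy1 f.1 u v w).trans (le_of_eq ?_)
    rw [mul_comm (u.length + v.length + w.length + 1), pow_mul, ← hΓ]
    rw [show Γ ^ (u.length + v.length + w.length + 1) *
        (Real.exp (y ^ 3) * y ^ 3 * y⁻¹ ^ (u.length + v.length + w.length)) =
        X * (Γ * y⁻¹) ^ (u.length + v.length + w.length) by rw [hX, mul_pow, pow_succ]; ring,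
      hΓy, ENNReal.ofReal_mul hX0, ENNReal.ofReal_pow (by positivity), pow_add, pow_add]
    ring
  refine (ENNReal.tsum_le_tsum h1).trans (le_of_eq ?_)
  let r : List (Fin d × Bool × Bool) → ENNReal := fun w =>
    ENNReal.ofReal (1 / (8 * d)) ^ w.length
  have hr : ∑' w, r w = 2 := tsum_words hd
  have hsum := tsum_prod_mul (fun f : ballEdges d n => law d {U | pPivotal κ n p f.1 U})
    (fun q : List (Fin d × Bool × Bool) × List (Fin d × Bool × Bool) ×
      List (Fin d × Bool × Bool) => r q.1 * (r q.2.1 * r q.2.2))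
  rw [tsum_prod_mul r (fun q : List (Fin d × Bool × Bool) × List (Fin d × Bool × Bool) =>
    r q.1 * r q.2), tsum_prod_mul r r, hr] at hsum
  rw [ENNReal.tsum_mul_left, hsum, ENNReal.ofReal_mul hX0]
  have : ENNReal.ofReal 8 = 2 * (2 * 2) := by
    rw [show (8 : ℝ) = ((8 : ℕ) : ℝ) by norm_num, ENNReal.ofReal_natCast]
    norm_num
  rw [this]
  ring

/-- **Pivotality transfer**: there is a constant `C = C(p₋, p₊, d) > 0`, uniform over
`p ∈ [p₋, p₊] ⊂ (0,1)`, such that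
`Σ_e ℙ(e is U-pivotal) ≤ C · Σ_e ℙ(e is p-pivotal)` for every `n ≥ 1`. -/
theorem pivotality_transfer (d κ : ℕ) (hd : 2 ≤ d) (hκ₁ : 2 ≤ κ) (hκ₂ : κ ≤ 2 * d)
    (P : Measure (Config d)) (hP : IsProductUniform P)
    (pm pp : ℝ) (h0 : 0 < pm) (h1 : pm < pp) (h2 : pp < 1) :
    ∃ C : ℝ, 0 < C ∧ ∀ p ∈ Set.Icc pm pp, ∀ n : ℕ, 1 ≤ n →
      (∑' e : {e : Sym2 (Vertex d) // IsNNEdge e}, (P {U | uPivotal κ n p e.1 U}).toReal) ≤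
        C * ∑' e : {e : Sym2 (Vertex d) // IsNNEdge e}, (P {U | pPivotal κ n p e.1 U}).toReal := by
  obtain rfl : P = law d := hP.eq_infinitePi
  set c := min pm (1 - pp) with hc
  have hc0 : 0 < c := lt_min h0 (by linarith)
  have hd' : (0 : ℝ) < d := by exact_mod_cast (show 0 < d by omega)
  set Γ := (4 * c⁻¹) ^ (d * 4 * (d * 4)) with hΓ
  set y := 8 * d * Γ with hy
  have hΓ0 : 0 < Γ := by positivity
  have hy0 : 0 < y := by positivity
  have hC : 0 < Γ * (Real.exp (y ^ 3) * y ^ 3) * 8 := by positivity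
  refine ⟨Γ * (Real.exp (y ^ 3) * y ^ 3) * 8, hC, fun p hp n hn => ?_⟩
  have hcp : c ≤ p := (min_le_left _ _).trans hp.1
  have hc1 : c ≤ 1 - p := (min_le_right _ _).trans (by linarith [hp.2])
  have key := tsum_uPivotal_le (d := d) (κ := κ) (n := n) (by omega) hκ₁ hn hc0 hcp hc1 hΓ hy
  set C := Γ * (Real.exp (y ^ 3) * y ^ 3) * 8
  have hball : ∑' f : ballEdges d n, law d {U | pPivotal κ n p f.1 U} ≤
      ∑' e : {e : Sym2 (Vertex d) // IsNNEdge e}, law d {U | pPivotal κ n p e.1 U} :=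
    ENNReal.tsum_comp_le_tsum_of_injective
      (f := fun f : ballEdges d n => (⟨f.1, f.2.1⟩ : {e : Sym2 (Vertex d) // IsNNEdge e}))
      (fun a b hab => Subtype.ext (congrArg (fun e => e.1) hab))
      (fun e => law d {U | pPivotal κ n p e.1 U})
  have hballfin : ∑' f : ballEdges d n, law d {U | pPivotal κ n p f.1 U} ≠ ⊤ := by
    have : Fintype (ballEdges d n) := (finite_ballEdges d n).fintype
    rw [tsum_fintype]
    exact ENNReal.sum_ne_top.2 fun _ _ => measure_ne_top _ _
  have hpu : ∑' e : {e : Sym2 (Vertex d) // IsNNEdge e}, law d {U | pPivotal κ n p e.1 U} ≤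
      ∑' e : {e : Sym2 (Vertex d) // IsNNEdge e}, law d {U | uPivotal κ n p e.1 U} :=
    ENNReal.tsum_le_tsum fun e => measure_mono fun U hU =>
      ⟨hU.1, _, hU.2.2.1, fun f hf => Function.update_of_ne hf _ _, hU.2.2.2⟩
  have hfin : ∑' e : {e : Sym2 (Vertex d) // IsNNEdge e},
      law d {U | pPivotal κ n p e.1 U} ≠ ⊤ :=
    ne_top_of_le_ne_top (ENNReal.mul_ne_top ENNReal.ofReal_ne_top hballfin) (hpu.trans key)
  have hmain := key.trans (mul_le_mul_right hball (ENNReal.ofReal C))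
  have hreal := ENNReal.toReal_mono (ENNReal.mul_ne_top ENNReal.ofReal_ne_top hfin) hmain
  rw [ENNReal.toReal_mul, ENNReal.toReal_ofReal hC.le,
    ENNReal.tsum_toReal_eq fun _ => measure_ne_top _ _,
    ENNReal.tsum_toReal_eq fun _ => measure_ne_top _ _] at hreal
  exact hreal

end CDP
end

section
/- Let 0 ≤ p_− < p_+ ≤ 1 and let (f_n)_{n≥0} be a pointwise converging sequence of differentiable functions f_n : [p_−, p_+] → [0,1] such that, for all n ≥ 1 and all p ∈ [p_−,p_+], Σ_n(p) := Σ_{k=0}^{n−1} f_k(p) > 0 and f_n′(p) ≥ (n / Σ_n(p)) · f_n(p). Then there exists p_* ∈ [p_−, p_+] such that: (1) for every p < p_* there exists c_p > 0 such that f_n(p) ≤ exp(−c_p n) for all n large enough; (2) for every p > p_*, the limit f(p) = lim_{n→∞} f_n(p) satisfies f(p) ≥ p − p_*. -/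
/-- A lower bound on the derivative within an ambient set `s` bounds the increment from below. -/
theorem mul_sub_le_sub_of_le_hasDerivWithinAt {g g' : ℝ → ℝ} {s : Set ℝ} {a b c : ℝ}
    (hab : a ≤ b) (hs : Set.Icc a b ⊆ s) (hg : ∀ x ∈ s, HasDerivWithinAt g (g' x) s x)
    (hc : ∀ x ∈ Set.Icc a b, c ≤ g' x) : c * (b - a) ≤ g b - g a := by
  have hd : ∀ x ∈ interior (Set.Icc a b), HasDerivAt g (g' x) x := fun x hx =>
    (hg x (hs (interior_subset hx))).hasDerivAt
      (Filter.mem_of_superset (mem_interior_iff_mem_nhds.1 hx) hs)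
  refine (convex_Icc a b).mul_sub_le_image_sub_of_le_deriv
    (fun x hx => ((hg x (hs hx)).mono hs).continuousWithinAt)
    (fun x hx => (hd x hx).differentiableAt.differentiableWithinAt)
    (fun x hx => ?_) a (Set.left_mem_Icc.2 hab) b (Set.right_mem_Icc.2 hab) hab
  rw [(hd x hx).deriv]
  exact hc x (interior_subset hx)

/-- Grönwall backwards in time: if `r * g ≤ g'` and `g b ≤ 1` then `g a ≤ exp (-(r * (b - a)))`. -/
theorem le_exp_neg_of_mul_le_hasDerivWithinAt {g g' : ℝ → ℝ} {s : Set ℝ} {a b r : ℝ}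
    (hab : a ≤ b) (hs : Set.Icc a b ⊆ s) (hg : ∀ x ∈ s, HasDerivWithinAt g (g' x) s x)
    (hr : ∀ x ∈ Set.Icc a b, r * g x ≤ g' x) (hb : g b ≤ 1) :
    g a ≤ Real.exp (-(r * (b - a))) := by
  have hexp : ∀ x ∈ s, HasDerivWithinAt (fun y => g y * Real.exp (-(r * y)))
      (g' x * Real.exp (-(r * x)) + g x * (Real.exp (-(r * x)) * (-(r * 1)))) s x := fun x hx =>
    (hg x hx).mul (((hasDerivAt_id x).const_mul r).neg.exp.hasDerivWithinAt)
  have h := mul_sub_le_sub_of_le_hasDerivWithinAt (c := 0) hab hs hexp (fun x hx => by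
    have := mul_nonneg (sub_nonneg.2 (hr x hx)) (Real.exp_pos (-(r * x))).le
    linarith)
  have h1 : g a * Real.exp (-(r * a)) ≤ Real.exp (-(r * b)) := by
    have := mul_le_mul_of_nonneg_right hb (Real.exp_pos (-(r * b))).le
    linarith
  calc g a = g a * Real.exp (-(r * a)) * Real.exp (r * a) := by
        rw [mul_assoc, ← Real.exp_add]; simp
    _ ≤ Real.exp (-(r * b)) * Real.exp (r * a) := by gcongr
    _ = Real.exp (-(r * (b - a))) := by rw [← Real.exp_add]; ring_nf

/-- Stretched exponentials are summable. -/
theorem summable_exp_neg_mul_rpow {c β : ℝ} (hc : 0 < c) (hβ : 0 < β) :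
    Summable fun n : ℕ => Real.exp (-(c * (n : ℝ) ^ β)) := by
  obtain ⟨k, hk⟩ := exists_nat_gt (2 / β)
  have hk2 : 2 < β * k := by rwa [div_lt_iff₀' hβ] at hk
  have hs : Summable fun n : ℕ => (k.factorial / c ^ k : ℝ) * (1 / (n : ℝ) ^ (β * k)) :=
    (Real.summable_one_div_nat_rpow.2 (by linarith)).mul_left _
  refine hs.of_norm_bounded_eventually_nat ?_
  filter_upwards [Filter.eventually_gt_atTop 0] with n hn
  have hn' : (0 : ℝ) < n := Nat.cast_pos.2 hn
  have hx : 0 < c * (n : ℝ) ^ β := by positivity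
  have h := Real.pow_div_factorial_le_exp _ hx.le k
  rw [Real.norm_of_nonneg (Real.exp_pos _).le, Real.exp_neg]
  calc (Real.exp (c * (n : ℝ) ^ β))⁻¹ ≤ ((c * (n : ℝ) ^ β) ^ k / k.factorial)⁻¹ := by gcongr
    _ = _ := by
      rw [Real.rpow_mul hn'.le, Real.rpow_natCast]
      field_simp
      exact (mul_pow _ _ _).symm

/-- If `u i ≤ M` for `i ≥ N`, the logarithmic sums of `u` are at most `M * log n + O(1)`. -/
theorem exists_sum_div_le_add_mul_log {u : ℕ → ℝ} {M : ℝ} (hM : 0 ≤ M)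
    (hu : ∀ᶠ i in Filter.atTop, u i ≤ M) :
    ∃ C, ∀ᶠ n : ℕ in Filter.atTop, ∑ i ∈ Finset.range n, u i / i ≤ C + M * Real.log n := by
  obtain ⟨N, hN⟩ := Filter.eventually_atTop.1 hu
  have hstep : ∀ n, N ≤ n → ∑ i ∈ Finset.range n, u i / i ≤
      ∑ i ∈ Finset.range N, u i / i + M * ∑ i ∈ Finset.range n, (i : ℝ)⁻¹ := by
    intro n hn
    induction n, hn using Nat.le_induction with
    | base =>
      exact le_add_of_nonneg_right (mul_nonneg hM (Finset.sum_nonneg fun i _ => by positivity))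
    | succ n hn ih =>
      rw [Finset.sum_range_succ, Finset.sum_range_succ (fun i : ℕ => (i : ℝ)⁻¹), mul_add,
        div_eq_mul_inv]
      have : u n * (n : ℝ)⁻¹ ≤ M * (n : ℝ)⁻¹ := by gcongr; exact hN n hn
      linarith
  refine ⟨∑ i ∈ Finset.range N, u i / i + M, ?_⟩
  filter_upwards [Filter.eventually_ge_atTop N] with n hn
  have hH : ∑ i ∈ Finset.range n, (i : ℝ)⁻¹ ≤ 1 + Real.log n := by
    calc ∑ i ∈ Finset.range n, (i : ℝ)⁻¹ ≤ ∑ i ∈ Finset.range (n + 1), (i : ℝ)⁻¹ :=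
          Finset.sum_le_sum_of_subset_of_nonneg (Finset.range_subset_range.2 n.le_succ)
            fun i _ _ => by positivity
      _ = (harmonic n : ℝ) := by rw [Finset.sum_range_succ']; simp [harmonic]
      _ ≤ _ := harmonic_le_one_add_log n
  have := hstep n hn
  have := mul_le_mul_of_nonneg_left hH hM
  linarith

/-- Telescoping `log (S (i + 1) / S i) ≤ a i / S i` for partial sums `S`. -/
theorem log_sum_range_le_sum_div {a a' : ℕ → ℝ} (h0 : a 0 ≤ 1)
    (hS : ∀ n, 1 ≤ n → 0 < ∑ k ∈ Finset.range n, a k)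
    (ha : ∀ n : ℕ, 1 ≤ n → (n : ℝ) / (∑ k ∈ Finset.range n, a k) * a n ≤ a' n)
    {n : ℕ} (hn : 1 ≤ n) :
    Real.log (∑ k ∈ Finset.range n, a k) ≤ ∑ i ∈ Finset.range n, a' i / i := by
  induction n, hn using Nat.le_induction with
  | base =>
    have := hS 1 le_rfl
    simp only [Finset.sum_range_one] at this ⊢
    simpa using Real.log_nonpos this.le h0
  | succ n hn ih =>
    have hn' : (0 : ℝ) < n := by exact_mod_cast hn
    have hpos := hS n hn
    have hpos' := hS (n + 1) (by omega)
    have hlog := Real.log_le_sub_one_of_pos (div_pos hpos' hpos)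
    rw [Real.log_div hpos'.ne' hpos.ne'] at hlog
    have hterm : (∑ k ∈ Finset.range (n + 1), a k) / (∑ k ∈ Finset.range n, a k) - 1
        ≤ a' n / n := by
      rw [le_div_iff₀ hn', Finset.sum_range_succ]
      calc _ = (n : ℝ) / (∑ k ∈ Finset.range n, a k) * a n := by field_simp; ring
        _ ≤ _ := ha n hn
    rw [Finset.sum_range_succ (fun i : ℕ => a' i / i)]
    linarith

/-- Terms `u n ≤ v n` for `n ≥ 1` give comparable partial sums, up to `u 0 - v 0 ≤ 1`. -/
theorem sum_range_le_one_add_sum_range {u v : ℕ → ℝ} (hu : u 0 ≤ 1) (hv : 0 ≤ v 0)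
    (huv : ∀ n, 1 ≤ n → u n ≤ v n) (n : ℕ) :
    ∑ k ∈ Finset.range n, u k ≤ 1 + ∑ k ∈ Finset.range n, v k := by
  cases n with
  | zero => simp
  | succ n =>
    rw [Finset.sum_range_succ', Finset.sum_range_succ']
    have := Finset.sum_le_sum fun k (_ : k ∈ Finset.range n) => huv (k + 1) (by omega)
    linarith

/-- **Differential inequality implies sharpness**: if `f_n : [p₋, p₊] → [0,1]` are
differentiable, converge pointwise, and satisfy `f_n' ≥ (n / Σ_n) f_n` with
`Σ_n = Σ_{k<n} f_k > 0`, then there is `p⋆ ∈ [p₋, p₊]` such that `f_n(p)` decays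
exponentially for `p < p⋆` and the limit `f(p)` is at least `p − p⋆` for `p > p⋆`. -/
theorem differential_inequality_implies_sharpness
    (pm pp : ℝ) (hpm : 0 ≤ pm) (hlt : pm < pp) (hpp : pp ≤ 1)
    (f f' : ℕ → ℝ → ℝ)
    (hval : ∀ n, ∀ p ∈ Set.Icc pm pp, f n p ∈ Set.Icc (0 : ℝ) 1)
    (hderiv : ∀ n, ∀ p ∈ Set.Icc pm pp, HasDerivWithinAt (f n) (f' n p) (Set.Icc pm pp) p)
    (hconv : ∀ p ∈ Set.Icc pm pp, ∃ L, Filter.Tendsto (fun n => f n p) Filter.atTop (nhds L))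
    (hineq : ∀ n, 1 ≤ n → ∀ p ∈ Set.Icc pm pp,
      0 < ∑ k ∈ Finset.range n, f k p ∧
        ((n : ℝ) / ∑ k ∈ Finset.range n, f k p) * f n p ≤ f' n p) :
    ∃ ps ∈ Set.Icc pm pp,
      (∀ p ∈ Set.Icc pm pp, p < ps →
        ∃ c : ℝ, 0 < c ∧ ∀ᶠ n in Filter.atTop, f n p ≤ Real.exp (-(c * n))) ∧
      (∀ p ∈ Set.Icc pm pp, ps < p →
        ∀ L, Filter.Tendsto (fun n => f n p) Filter.atTop (nhds L) → p - ps ≤ L) := by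
  have hmono : ∀ n, 1 ≤ n → ∀ a ∈ Set.Icc pm pp, ∀ b ∈ Set.Icc pm pp, a ≤ b → f n a ≤ f n b := by
    intro n hn a ha b hb hab
    have h := mul_sub_le_sub_of_le_hasDerivWithinAt (c := 0) hab (Set.Icc_subset_Icc ha.1 hb.2)
      (hderiv n) (fun x hx => by
        have hx' := Set.Icc_subset_Icc ha.1 hb.2 hx
        obtain ⟨h1, h2⟩ := hineq n hn x hx'
        exact le_trans (mul_nonneg (by positivity) (hval n x hx').1) h2)
    linarith
  have hsum : ∀ n, ∀ a ∈ Set.Icc pm pp, ∀ b ∈ Set.Icc pm pp, a ≤ b →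
      ∑ k ∈ Finset.range n, f k a ≤ 1 + ∑ k ∈ Finset.range n, f k b := fun n a ha b hb hab =>
    sum_range_le_one_add_sum_range (hval 0 a ha).2 (hval 0 b hb).1
      (fun k hk => hmono k hk a ha b hb hab) n
  have hdecay : ∀ n, 1 ≤ n → ∀ a ∈ Set.Icc pm pp, ∀ b ∈ Set.Icc pm pp, a ≤ b → ∀ K,
      ∑ k ∈ Finset.range n, f k b ≤ K → f n a ≤ Real.exp (-(n / (1 + K) * (b - a))) := by
    intro n hn a ha b hb hab K hK
    refine le_exp_neg_of_mul_le_hasDerivWithinAt hab (Set.Icc_subset_Icc ha.1 hb.2) (hderiv n)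
      (fun x hx => ?_) (hval n b hb).2
    have hx' := Set.Icc_subset_Icc ha.1 hb.2 hx
    obtain ⟨h1, h2⟩ := hineq n hn x hx'
    refine le_trans (mul_le_mul_of_nonneg_right ?_ (hval n x hx').1) h2
    gcongr
    exact (hsum n x hx' b hb hx.2).trans (by linarith)
  let S : Set ℝ := {p | p ∈ Set.Icc pm pp ∧ ∃ α : ℝ, 0 ≤ α ∧ α < 1 ∧
    ∀ᶠ n : ℕ in Filter.atTop, ∑ k ∈ Finset.range n, f k p ≤ (n : ℝ) ^ α}
  have hT : insert pm S ⊆ Set.Icc pm pp :=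
    Set.insert_subset (Set.left_mem_Icc.2 hlt.le) fun x hx => hx.1
  have hbdd : BddAbove (insert pm S) := bddAbove_Icc.mono hT
  have hps : sSup (insert pm S) ∈ Set.Icc pm pp :=
    ⟨le_csSup hbdd (Set.mem_insert _ _), csSup_le (Set.insert_nonempty _ _) fun x hx => (hT hx).2⟩
  refine ⟨sSup (insert pm S), hps, ?_, ?_⟩
  · intro p hp hlt'
    obtain ⟨s, hsS, hs⟩ := exists_lt_of_lt_csSup (Set.insert_nonempty _ _) hlt'
    have hsI := hT hsS
    obtain ⟨-, α, hα0, hα1, hα⟩ : s ∈ S :=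
      hsS.resolve_left fun h => absurd hp.1 (not_le.2 (h ▸ hs))
    obtain ⟨m, hpm', hms⟩ := exists_between hs
    have hmI : m ∈ Set.Icc pm pp := ⟨hp.1.trans hpm'.le, hms.le.trans hsI.2⟩
    have hsummable : Summable fun n => f n m := by
      have hc : 0 < (s - m) / 2 := by linarith
      refine (summable_exp_neg_mul_rpow hc (sub_pos.2 hα1)).of_norm_bounded_eventually_nat ?_
      filter_upwards [hα, Filter.eventually_ge_atTop 1] with n hn hn1
      rw [Real.norm_of_nonneg (hval n m hmI).1]
      refine (hdecay n hn1 m hmI s hsI hms.le _ hn).trans (Real.exp_le_exp.2 (neg_le_neg ?_))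
      have hn1' : (1 : ℝ) ≤ n := by exact_mod_cast hn1
      have hpow : 1 ≤ (n : ℝ) ^ α := Real.one_le_rpow hn1' hα0
      have hpos : (0 : ℝ) < n := by linarith
      calc (s - m) / 2 * (n : ℝ) ^ (1 - α) = n / ((n : ℝ) ^ α + (n : ℝ) ^ α) * (s - m) := by
            rw [Real.rpow_sub hpos, Real.rpow_one]; field_simp; norm_num
        _ ≤ n / (1 + (n : ℝ) ^ α) * (s - m) := by
            have : 0 ≤ s - m := by linarith
            gcongr
    have hC : 0 ≤ ∑' n, f n m := tsum_nonneg fun n => (hval n m hmI).1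
    refine ⟨(m - p) / (1 + ∑' n, f n m), div_pos (by linarith) (by linarith), ?_⟩
    filter_upwards [Filter.eventually_ge_atTop 1] with n hn
    refine (hdecay n hn p hp m hmI hpm'.le _
      (hsummable.sum_le_tsum _ fun k _ => (hval k m hmI).1)).trans_eq ?_
    congr 2
    ring
  · intro p hp hlt' L hL
    set ps := sSup (insert pm S)
    by_contra! hcon
    set d := p - ps - L with hd
    have hd0 : 0 < d := by linarith
    have hL0 : 0 ≤ L := ge_of_tendsto' hL fun n => (hval n p hp).1
    have hd1 : d ≤ 1 := by linarith [hp.2, hps.1]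
    have hqp : ps + d / 4 < p := by linarith
    have hqI : ps + d / 4 ∈ Set.Icc pm pp := ⟨by linarith [hps.1], by linarith [hp.2]⟩
    have hfreq : ∃ᶠ n : ℕ in Filter.atTop,
        (n : ℝ) ^ (1 - d / 8) < ∑ k ∈ Finset.range n, f k (ps + d / 4) := by
      intro hev
      have hmem : ps + d / 4 ∈ S := ⟨hqI, 1 - d / 8, by linarith, by linarith, by
        filter_upwards [hev] with n hn using not_lt.1 hn⟩
      have := le_csSup hbdd (Set.mem_insert_of_mem pm hmem)
      linarith
    obtain ⟨C, hC⟩ := exists_sum_div_le_add_mul_log (M := L + d / 4) (by linarith)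
      (hL.eventually (eventually_le_nhds (by linarith)))
    have hpow : ∀ᶠ n : ℕ in Filter.atTop, (2 : ℝ) ≤ (n : ℝ) ^ (d / 8) :=
      ((tendsto_rpow_atTop (by linarith)).comp tendsto_natCast_atTop_atTop).eventually_ge_atTop 2
    have hlog : ∀ᶠ n : ℕ in Filter.atTop, C + 1 ≤ d / 4 * Real.log n :=
      ((Real.tendsto_log_atTop.comp tendsto_natCast_atTop_atTop).const_mul_atTop
        (by linarith)).eventually_ge_atTop (C + 1)
    obtain ⟨n, hn, hCn, h2, hlogn, hn1⟩ :=
      (hfreq.and_eventually (hC.and (hpow.and (hlog.and (Filter.eventually_ge_atTop 1))))).exists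
    have hn1' : (1 : ℝ) ≤ n := by exact_mod_cast hn1
    have hpos : (0 : ℝ) < n := by linarith
    have hgrow : (n : ℝ) ^ (1 - d / 4) + 1 ≤ (n : ℝ) ^ (1 - d / 8) := by
      have h1 : 1 ≤ (n : ℝ) ^ (1 - d / 4) := Real.one_le_rpow hn1' (by linarith)
      rw [show 1 - d / 8 = (1 - d / 4) + d / 8 by ring, Real.rpow_add hpos]
      nlinarith
    have hU : (1 - d / 4) * Real.log n * (p - (ps + d / 4)) ≤
        ∑ i ∈ Finset.range n, f i p / i - ∑ i ∈ Finset.range n, f i (ps + d / 4) / i := by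
      refine mul_sub_le_sub_of_le_hasDerivWithinAt (g := fun x => ∑ i ∈ Finset.range n, f i x / i)
        (g' := fun x => ∑ i ∈ Finset.range n, f' i x / i) hqp.le
        (Set.Icc_subset_Icc hqI.1 hp.2)
        (fun x hx => HasDerivWithinAt.fun_sum fun i _ => (hderiv i x hx).div_const _)
        (fun x hx => ?_)
      have hx' := Set.Icc_subset_Icc hqI.1 hp.2 hx
      refine le_trans ?_ (log_sum_range_le_sum_div (hval 0 x hx').2
        (fun k hk => (hineq k hk x hx').1) (fun k hk => (hineq k hk x hx').2) hn1)
      rw [← Real.log_rpow hpos]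
      exact Real.log_le_log (by positivity)
        (by linarith [hsum n _ hqI x hx' hx.1])
    have hU0 : 0 ≤ ∑ i ∈ Finset.range n, f i (ps + d / 4) / i :=
      Finset.sum_nonneg fun i _ => div_nonneg (hval i _ hqI).1 (Nat.cast_nonneg i)
    have hkey : L + d / 2 ≤ (1 - d / 4) * (p - (ps + d / 4)) := by
      have : p - (ps + d / 4) ≤ 1 := by linarith [hp.2, hps.1]
      nlinarith
    have hfin := mul_le_mul_of_nonneg_right hkey (Real.log_nonneg hn1')
    nlinarith
end
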